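/- Let R be a d-dimensional Cohen-Macaulay commutative noetherian ring with a dualizing module D. If G is a Gorenstein injective R-module, then G has a filtration 0 = G_{d+1} ⊂ G_d ⊂ ⋯ ⊂ G_1 ⊂ G_0 = G such that each submodule G_k is Gorenstein injective, each quotient G_k/G_{k+1} is Gorenstein injective and decomposes as G_k/G_{k+1} ≅ ⊕_{ht(p)=k} G_{(p)}, where G_{(p)} := Tor_k^R(Hom_R(D, E_R(R/p)), G), and each module G_{(p)} is Gorenstein injective and satisfies property t(p). -/

import Mathlib

/-!
Common definitions: property t(p), injective hulls, (C-)Gorenstein injective modules,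
(C-)Gorenstein injective / injective / flat dimensions, small support, torsion functor,
Tor and Ext modules, semidualizing and dualizing modules, depth, Cohen-Macaulay rings,
Serre's condition (S₁), Gorenstein local rings, minimal injective resolutions.
-/

universe u

open CategoryTheory Limits DirectSum

noncomputable section

/-- An `R`-module `S` has property `t(p)`: multiplication by every `r ∉ p` is bijective on `S`,
and every element of `S` is annihilated by a power of `p`. -/
def PropT (R : Type u) [CommRing R] (p : Ideal R) (S : Type u) [AddCommGroup S]
    [Module R S] : Prop :=
  (∀ r : R, r ∉ p → Function.Bijective (fun s : S => r • s)) ∧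
  (∀ x : S, ∃ m : ℕ, 0 < m ∧ ∀ a ∈ p ^ m, a • x = 0)

/-- `E` is an injective hull of `N` over `R`: `E` is injective and `N` embeds in `E` as an
essential submodule. -/
def IsInjectiveHull (R : Type u) [CommRing R] (N : Type u) [AddCommGroup N] [Module R N]
    (E : Type u) [AddCommGroup E] [Module R E] : Prop :=
  Module.Injective R E ∧ ∃ ι : N →ₗ[R] E, Function.Injective ι ∧
    ∀ K : Submodule R E, K ≠ ⊥ → K ⊓ LinearMap.range ι ≠ ⊥

/-- A complete injective resolution: a doubly infinite exact sequence of injective modules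
which stays exact after applying `Hom_R(-, I)` for every injective module `I`. -/
structure CompleteInjRes (R : Type u) [CommRing R] where
  E : ℤ → Type u
  [acg : ∀ i, AddCommGroup (E i)]
  [mod : ∀ i, Module R (E i)]
  d : ∀ i, E i →ₗ[R] E (i + 1)
  inj : ∀ i, Module.Injective R (E i)
  exct : ∀ i, LinearMap.range (d i) = LinearMap.ker (d (i + 1))
  homExact : ∀ (I : Type u) [AddCommGroup I] [Module R I], Module.Injective R I →
    ∀ (i : ℤ) (g : E (i + 1) →ₗ[R] I), g ∘ₗ d i = 0 →
      ∃ h : E (i + 1 + 1) →ₗ[R] I, h ∘ₗ d (i + 1) = g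

attribute [instance] CompleteInjRes.acg CompleteInjRes.mod

/-- `G` is a Gorenstein injective `R`-module: it is the image of some map in a complete
injective resolution. -/
def GorensteinInjective (R : Type u) [CommRing R] (G : Type u) [AddCommGroup G]
    [Module R G] : Prop :=
  ∃ X : CompleteInjRes R, Nonempty (G ≃ₗ[R] LinearMap.range (X.d 0))

/-- A complete `I_C I`-resolution: an exact sequence
`⋯ → Hom(C,I₁) → Hom(C,I₀) → I⁰ → I¹ → ⋯` (terms in nonnegative degrees are injective,
terms in negative degrees are of the form `Hom_R(C, I)` with `I` injective) such that
`Hom_R(Hom_R(C,J), -)` leaves it exact for every injective `R`-module `J`. -/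
structure CompleteICIRes (R : Type u) [CommRing R] (C : Type u) [AddCommGroup C]
    [Module R C] where
  X : ℤ → Type u
  [acg : ∀ i, AddCommGroup (X i)]
  [mod : ∀ i, Module R (X i)]
  d : ∀ i, X i →ₗ[R] X (i + 1)
  exct : ∀ i, LinearMap.range (d i) = LinearMap.ker (d (i + 1))
  injPos : ∀ i : ℤ, 0 ≤ i → Module.Injective R (X i)
  homCInjNeg : ∀ i : ℤ, i < 0 → ∃ (I : Type u) (_ : AddCommGroup I) (_ : Module R I),
    Module.Injective R I ∧ Nonempty (X i ≃ₗ[R] (C →ₗ[R] I))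
  homExact : ∀ (J : Type u) [AddCommGroup J] [Module R J], Module.Injective R J →
    ∀ (i : ℤ) (g : (C →ₗ[R] J) →ₗ[R] X (i + 1)), d (i + 1) ∘ₗ g = 0 →
      ∃ h : (C →ₗ[R] J) →ₗ[R] X i, d i ∘ₗ h = g

attribute [instance] CompleteICIRes.acg CompleteICIRes.mod

/-- `G` is a `C`-Gorenstein injective `R`-module: it is the image of the map
`Hom_R(C, I₀) → I⁰` in some complete `I_C I`-resolution. -/
def CGorensteinInjective (R : Type u) [CommRing R] (C : Type u) [AddCommGroup C] [Module R C]
    (G : Type u) [AddCommGroup G] [Module R G] : Prop :=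
  ∃ X : CompleteICIRes R C, Nonempty (G ≃ₗ[R] LinearMap.range (X.d (-1)))

/-- `M` has a `C`-Gorenstein injective coresolution `0 → M → G⁰ → ⋯ → Gⁿ → 0`,
i.e. `C`-Gorenstein injective dimension at most `n`. -/
def CGidLE (R : Type u) [CommRing R] (C : Type u) [AddCommGroup C] [Module R C] :
    ℕ → ModuleCat.{u} R → Prop
  | 0, M => CGorensteinInjective R C M
  | n + 1, M => ∃ (G : ModuleCat.{u} R), CGorensteinInjective R C G ∧
      ∃ ι : M →ₗ[R] G, Function.Injective ι ∧
        CGidLE R C n (ModuleCat.of R (G ⧸ LinearMap.range ι))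

/-- The `C`-Gorenstein injective dimension of `M` (equal to `⊤` if `M` admits no bounded
coresolution by `C`-Gorenstein injective modules). -/
def CGid (R : Type u) [CommRing R] (C : Type u) [AddCommGroup C] [Module R C]
    (M : Type u) [AddCommGroup M] [Module R M] : ℕ∞ :=
  sInf {n : ℕ∞ | ∃ m : ℕ, (m : ℕ∞) = n ∧ CGidLE R C m (ModuleCat.of R M)}

/-- There exists an exact sequence `0 → N → Gₙ → ⋯ → G₁ → M → 0` in which each `Gᵢ` is
`C`-Gorenstein injective (and `N` is arbitrary). -/
def CGICoresApprox (R : Type u) [CommRing R] (C : Type u) [AddCommGroup C] [Module R C] :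
    ℕ → ModuleCat.{u} R → Prop
  | 0, _ => True
  | n + 1, M => ∃ (G : ModuleCat.{u} R), CGorensteinInjective R C G ∧
      ∃ π : G →ₗ[R] M, Function.Surjective π ∧
        CGICoresApprox R C n (ModuleCat.of R (LinearMap.ker π))

/-- The `a`-torsion submodule `Γ_a(N)` of `N`. -/
def torsionSubmodule (R : Type u) [CommRing R] (a : Ideal R) (N : Type u) [AddCommGroup N]
    [Module R N] : Submodule R N :=
  ⨆ m : ℕ, Submodule.torsionBySet R N ((a ^ m : Ideal R) : Set R)

/-- `Tor_i^R(M, N)`, as an object of `ModuleCat R`. -/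
abbrev TorM (R : Type u) [CommRing R] (i : ℕ) (M N : Type u) [AddCommGroup M] [Module R M]
    [AddCommGroup N] [Module R N] : ModuleCat.{u} R :=
  ((Tor (ModuleCat.{u} R) i).obj (ModuleCat.of R M)).obj (ModuleCat.of R N)

/-- `Ext_R^i(M, N)`, as an object of `ModuleCat R`. -/
abbrev ExtM (R : Type u) [CommRing R] (i : ℕ) (M N : Type u) [AddCommGroup M] [Module R M]
    [AddCommGroup N] [Module R N] : ModuleCat.{u} R :=
  ((Ext R (ModuleCat.{u} R) i).obj (Opposite.op (ModuleCat.of R M))).obj (ModuleCat.of R N)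

/-- The small support of `M`: primes `p` such that `Tor_i^R(κ(p), M) ≠ 0` for some `i`,
where `κ(p)` is the residue field of `R_p`. -/
def smallSupport (R : Type u) [CommRing R] (M : Type u) [AddCommGroup M] [Module R M] :
    Set (PrimeSpectrum R) :=
  {p | ∃ i : ℕ,
    Nontrivial (TorM R i (IsLocalRing.ResidueField (Localization.AtPrime p.asIdeal)) M)}

/-- `C` is a semidualizing `R`-module: finitely generated, the homothety map
`R → Hom_R(C,C)` is bijective, and `Ext_R^i(C,C) = 0` for `i ≥ 1`. -/
def IsSemidualizing (R : Type u) [CommRing R] (C : Type u) [AddCommGroup C] [Module R C] : Prop :=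
  Module.Finite R C ∧
  Function.Bijective (fun r : R => (r • LinearMap.id : C →ₗ[R] C)) ∧
  ∀ i : ℕ, 1 ≤ i → Subsingleton (ExtM R i C C)

/-- `M` has injective dimension at most `n`. -/
def InjDimLE (R : Type u) [CommRing R] : ℕ → ModuleCat.{u} R → Prop
  | 0, M => Module.Injective R M
  | n + 1, M => ∃ (I : ModuleCat.{u} R), Module.Injective R I ∧
      ∃ ι : M →ₗ[R] I, Function.Injective ι ∧
        InjDimLE R n (ModuleCat.of R (I ⧸ LinearMap.range ι))

/-- `M` has flat dimension at most `n`. -/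
def FlatDimLE (R : Type u) [CommRing R] : ℕ → ModuleCat.{u} R → Prop
  | 0, M => Module.Flat R M
  | n + 1, M => ∃ (F : ModuleCat.{u} R), Module.Flat R F ∧
      ∃ π : F →ₗ[R] M, Function.Surjective π ∧
        FlatDimLE R n (ModuleCat.of R (LinearMap.ker π))

/-- `D` is a dualizing `R`-module: semidualizing of finite injective dimension. -/
def IsDualizing (R : Type u) [CommRing R] (D : Type u) [AddCommGroup D] [Module R D] : Prop :=
  IsSemidualizing R D ∧ ∃ n : ℕ, InjDimLE R n (ModuleCat.of R D)

/-- The depth of a local ring: the supremum of lengths of regular sequences contained in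
the maximal ideal. -/
def localRingDepth (A : Type u) [CommRing A] [IsLocalRing A] : ℕ∞ :=
  sSup {n : ℕ∞ | ∃ rs : List A, (∀ r ∈ rs, r ∈ IsLocalRing.maximalIdeal A) ∧
    RingTheory.Sequence.IsRegular A rs ∧ (rs.length : ℕ∞) = n}

/-- `R` is a Cohen-Macaulay ring: for each prime `p`, `depth (R_p) = dim (R_p)`. -/
def IsCohenMacaulayRing (R : Type u) [CommRing R] : Prop :=
  ∀ (p : Ideal R) (_ : p.IsPrime),
    (localRingDepth (Localization.AtPrime p) : WithBot ℕ∞) =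
      ringKrullDim (Localization.AtPrime p)

/-- Serre's condition `(S₁)`: `depth (R_p) ≥ min (ht p, 1)` for every prime `p`. -/
def SerreS1 (R : Type u) [CommRing R] : Prop :=
  ∀ (p : Ideal R) (hp : p.IsPrime),
    min (Order.height (⟨p, hp⟩ : PrimeSpectrum R)) 1 ≤ localRingDepth (Localization.AtPrime p)

/-- A Gorenstein local ring: a noetherian local ring of finite self-injective dimension. -/
def IsGorensteinLocalRing (A : Type u) [CommRing A] : Prop :=
  IsLocalRing A ∧ IsNoetherianRing A ∧ ∃ n : ℕ, InjDimLE A n (ModuleCat.of A A)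

/-- A minimal injective resolution `0 → D → J⁰ → J¹ → ⋯` of `D`: an exact sequence with all
`Jⁱ` injective, in which the kernel of each differential is an essential submodule. -/
structure MinimalInjRes (R : Type u) [CommRing R] (D : Type u) [AddCommGroup D]
    [Module R D] where
  J : ℕ → Type u
  [acg : ∀ i, AddCommGroup (J i)]
  [mod : ∀ i, Module R (J i)]
  ε : D →ₗ[R] J 0
  d : ∀ i, J i →ₗ[R] J (i + 1)
  inj : ∀ i, Module.Injective R (J i)
  ε_inj : Function.Injective ε
  exct0 : LinearMap.range ε = LinearMap.ker (d 0)
  exct : ∀ i, LinearMap.range (d i) = LinearMap.ker (d (i + 1))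
  minimal : ∀ i, ∀ K : Submodule R (J i), K ≠ ⊥ → K ⊓ LinearMap.ker (d i) ≠ ⊥

attribute [instance] MinimalInjRes.acg MinimalInjRes.mod

end

section InjectiveModules

variable {R : Type u} [CommRing R]

/-- A map into an injective module factors through any map with smaller kernel. -/
theorem Module.Injective.exists_comp_eq_of_ker_le {A B E : Type u} [AddCommGroup A] [Module R A]
    [AddCommGroup B] [Module R B] [AddCommGroup E] [Module R E] (hE : Module.Injective R E)
    (φ : A →ₗ[R] B) (ψ : A →ₗ[R] E) (h : LinearMap.ker φ ≤ LinearMap.ker ψ) :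
    ∃ g : B →ₗ[R] E, g ∘ₗ φ = ψ := by
  have hinj : Function.Injective ((LinearMap.ker φ).liftQ φ le_rfl) := by
    rw [← LinearMap.ker_eq_bot, Submodule.ker_liftQ_eq_bot _ _ _ le_rfl]
  obtain ⟨g, hg⟩ := (Module.Baer.of_injective hE).extension_property
    ((LinearMap.ker φ).liftQ φ le_rfl) hinj ((LinearMap.ker φ).liftQ ψ h)
  refine ⟨g, ?_⟩
  ext a
  have := LinearMap.congr_fun hg (Submodule.Quotient.mk a)
  simpa using this

theorem Module.Injective.of_retract {A E : Type u} [AddCommGroup A] [Module R A]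
    [AddCommGroup E] [Module R E] (hE : Module.Injective R E) (i : A →ₗ[R] E) (r : E →ₗ[R] A)
    (h : r ∘ₗ i = LinearMap.id) : Module.Injective R A := by
  refine ⟨fun X Y _ _ _ _ f hf g => ?_⟩
  obtain ⟨k, hk⟩ := hE.out f hf (i ∘ₗ g)
  exact ⟨r ∘ₗ k, fun x => by simpa [hk x] using LinearMap.congr_fun h (g x)⟩

theorem Module.Injective.of_linearEquiv {A E : Type u} [AddCommGroup A] [Module R A]
    [AddCommGroup E] [Module R E] (hE : Module.Injective R E) (e : A ≃ₗ[R] E) :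
    Module.Injective R A :=
  hE.of_retract e.toLinearMap e.symm.toLinearMap (by ext; simp)

/-- Quotients of injective modules by injective submodules are injective. -/
theorem Module.Injective.quotient {E : Type u} [AddCommGroup E] [Module R E]
    (hE : Module.Injective R E) (N : Submodule R E) (hN : Module.Injective R N) :
    Module.Injective R (E ⧸ N) := by
  obtain ⟨r, hr⟩ := (Module.Baer.of_injective hN).extension_property N.subtype
    N.injective_subtype LinearMap.id
  have hr' : ∀ x (hx : x ∈ N), r x = ⟨x, hx⟩ := fun x hx => LinearMap.congr_fun hr ⟨x, hx⟩
  refine hE.of_retract (N.liftQ (LinearMap.id - N.subtype ∘ₗ r) fun x hx => ?_) N.mkQ ?_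
  · simp [hr' x hx]
  · ext x
    simp

theorem Module.Injective.exists_pow_smul_eq [IsNoetherianRing R] {E : Type u} [AddCommGroup E]
    [Module R E] (hE : Module.Injective R E) (s : R) (y : E) :
    ∃ m : ℕ, ∀ n : ℕ, ∃ z : E, s ^ (m + n) • z = s ^ m • y := by
  obtain ⟨m, hm⟩ := monotone_stabilizes_iff_noetherian.mpr ‹IsNoetherianRing R›
    ⟨fun n => LinearMap.ker (LinearMap.toSpanSingleton R R (s ^ n)), fun a b hab x hx => by
      obtain ⟨c, rfl⟩ := Nat.exists_eq_add_of_le hab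
      simp only [LinearMap.mem_ker, LinearMap.toSpanSingleton_apply, smul_eq_mul] at hx ⊢
      rw [pow_add, ← mul_assoc, hx, zero_mul]⟩
  refine ⟨m, fun n => ?_⟩
  obtain ⟨g, hg⟩ := hE.exists_comp_eq_of_ker_le
    (LinearMap.toSpanSingleton R R (s ^ (m + n))) (LinearMap.toSpanSingleton R E (s ^ m • y)) (by
      rw [show LinearMap.ker (LinearMap.toSpanSingleton R R (s ^ (m + n))) = _ from
        (hm (m + n) (Nat.le_add_right m n)).symm]
      intro x hx
      replace hx : x * s ^ m = 0 := hx
      simp only [LinearMap.mem_ker, LinearMap.toSpanSingleton_apply]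
      rw [smul_smul, hx, zero_smul])
  refine ⟨g 1, ?_⟩
  have := LinearMap.congr_fun hg 1
  simp only [LinearMap.comp_apply, LinearMap.toSpanSingleton_apply, one_smul] at this
  rw [← map_smul, ← this]
  simp

end InjectiveModules

section Support

variable {R : Type u} [CommRing R]

/-- The submodule of elements supported in a set `V` of primes. -/
def supportedSubmodule (V : Set (PrimeSpectrum R)) (M : Type u) [AddCommGroup M] [Module R M] :
    Submodule R M where
  carrier := {m | ∀ q : PrimeSpectrum R, Ideal.torsionOf R M m ≤ q.asIdeal → q ∈ V}
  zero_mem' := fun q hq => (q.isPrime.ne_top (by simpa using hq)).elim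
  add_mem' := by
    intro a b ha hb q hq
    have : Ideal.torsionOf R M a ⊓ Ideal.torsionOf R M b ≤ q.asIdeal := by
      refine le_trans ?_ hq
      rintro r ⟨h1, h2⟩
      simp only [SetLike.mem_coe, Ideal.mem_torsionOf_iff] at h1 h2 ⊢
      rw [smul_add, h1, h2, add_zero]
    rcases q.isPrime.inf_le.mp this with h | h
    exacts [ha q h, hb q h]
  smul_mem' := by
    intro c m hm q hq
    refine hm q (le_trans ?_ hq)
    intro r hr
    simp only [Ideal.mem_torsionOf_iff] at hr ⊢
    rw [smul_comm, hr, smul_zero]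

theorem mem_supportedSubmodule {V : Set (PrimeSpectrum R)} {M : Type u} [AddCommGroup M]
    [Module R M] {m : M} : m ∈ supportedSubmodule V M ↔
      ∀ q : PrimeSpectrum R, Ideal.torsionOf R M m ≤ q.asIdeal → q ∈ V := Iff.rfl

theorem torsionOf_le_torsionOf_map {M N : Type u} [AddCommGroup M] [Module R M]
    [AddCommGroup N] [Module R N] (f : M →ₗ[R] N) (m : M) :
    Ideal.torsionOf R M m ≤ Ideal.torsionOf R N (f m) := by
  intro r hr
  simp only [Ideal.mem_torsionOf_iff] at hr ⊢
  rw [← map_smul, hr, map_zero]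

theorem torsionOf_map_of_injective {M N : Type u} [AddCommGroup M] [Module R M]
    [AddCommGroup N] [Module R N] (f : M →ₗ[R] N) (hf : Function.Injective f) (m : M) :
    Ideal.torsionOf R N (f m) = Ideal.torsionOf R M m := by
  refine le_antisymm (fun r hr => ?_) (torsionOf_le_torsionOf_map f m)
  simp only [Ideal.mem_torsionOf_iff] at hr ⊢
  exact hf (by rw [map_smul, hr, map_zero])

theorem map_mem_supportedSubmodule {V : Set (PrimeSpectrum R)} {M N : Type u} [AddCommGroup M]
    [Module R M] [AddCommGroup N] [Module R N] (f : M →ₗ[R] N) {m : M}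
    (hm : m ∈ supportedSubmodule V M) : f m ∈ supportedSubmodule V N :=
  fun q hq => hm q ((torsionOf_le_torsionOf_map f m).trans hq)

theorem map_mem_supportedSubmodule_iff {V : Set (PrimeSpectrum R)} {M N : Type u}
    [AddCommGroup M] [Module R M] [AddCommGroup N] [Module R N] (f : M →ₗ[R] N)
    (hf : Function.Injective f) {m : M} :
    f m ∈ supportedSubmodule V N ↔ m ∈ supportedSubmodule V M := by
  simp only [mem_supportedSubmodule, torsionOf_map_of_injective f hf]

/-- The restriction of a linear map to the elements supported in `V`. -/
def supportedMap (V : Set (PrimeSpectrum R)) {M N : Type u} [AddCommGroup M]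
    [Module R M] [AddCommGroup N] [Module R N] (f : M →ₗ[R] N) :
    supportedSubmodule V M →ₗ[R] supportedSubmodule V N :=
  f.restrict fun _ => map_mem_supportedSubmodule f

@[simp]
theorem coe_supportedMap (V : Set (PrimeSpectrum R)) {M N : Type u} [AddCommGroup M]
    [Module R M] [AddCommGroup N] [Module R N] (f : M →ₗ[R] N) (m : supportedSubmodule V M) :
    (supportedMap V f m : N) = f m := rfl

/-- The equivalence induced on elements supported in `V`. -/
def supportedEquiv (V : Set (PrimeSpectrum R)) {M N : Type u} [AddCommGroup M]
    [Module R M] [AddCommGroup N] [Module R N] (e : M ≃ₗ[R] N) :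
    supportedSubmodule V M ≃ₗ[R] supportedSubmodule V N :=
  LinearEquiv.ofLinearMap (supportedMap V e.toLinearMap) (supportedMap V e.symm.toLinearMap)
    (by ext; simp) (by ext; simp)

theorem mem_supportedSubmodule_zeroLocus [IsNoetherianRing R] {M : Type u} [AddCommGroup M]
    [Module R M] (s : Set R) {m : M} :
    m ∈ supportedSubmodule (PrimeSpectrum.zeroLocus s) M ↔ ∀ x ∈ s, ∃ n : ℕ, x ^ n • m = 0 := by
  rw [mem_supportedSubmodule]
  constructor
  · intro h x hx
    have : x ∈ (Ideal.torsionOf R M m).radical := by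
      rw [Ideal.radical_eq_sInf, Ideal.mem_sInf]
      rintro q ⟨hq, hqp⟩
      exact h ⟨q, hqp⟩ hq hx
    exact this
  · intro h q hq x hx
    obtain ⟨n, hn⟩ := h x hx
    exact q.isPrime.mem_of_pow_mem n (hq hn)

theorem supportedSubmodule_injective [IsNoetherianRing R] (V : Set (PrimeSpectrum R)) {E : Type u}
    [AddCommGroup E] [Module R E] (hE : Module.Injective R E) :
    Module.Injective R (supportedSubmodule V E) := by
  rw [← Module.Baer.iff_injective]
  intro J f
  obtain ⟨s, hs⟩ := IsNoetherian.noetherian J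
  have hsJ : ∀ j ∈ s, j ∈ J := fun j hj => hs ▸ Submodule.subset_span hj
  set a : Ideal R := s.attach.inf fun j => Ideal.torsionOf R _ (f ⟨j.1, hsJ j.1 j.2⟩) with ha
  have haV : ∀ q : PrimeSpectrum R, a ≤ q.asIdeal → q ∈ V := by
    intro q hq
    obtain ⟨j, -, hj⟩ := (q.isPrime.inf_le' ).mp hq
    refine (f ⟨j.1, hsJ j.1 j.2⟩).2 q (le_trans ?_ hj)
    intro r hr
    simp only [Ideal.mem_torsionOf_iff] at hr ⊢
    exact Subtype.ext hr
  have haf : ∀ r ∈ a, ∀ j : J, r • f j = 0 := by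
    intro r hr
    rintro ⟨j, hj⟩
    have : ∀ j' ∈ Submodule.span R (s : Set R), ∀ hj' : j' ∈ J, r • f ⟨j', hj'⟩ = 0 := by
      intro j' hj'
      induction hj' using Submodule.span_induction with
      | mem x hx =>
        intro hxJ
        have := (Finset.mem_attach s ⟨x, hx⟩)
        have h2 := (Finset.inf_le this : a ≤ _) hr
        simpa [Ideal.mem_torsionOf_iff] using h2
      | zero => intro h; rw [show (⟨0, h⟩ : J) = 0 from rfl, map_zero, smul_zero]
      | add x y hx hy hx' hy' =>
        intro h
        have hxJ : x ∈ J := hs ▸ hx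
        have hyJ : y ∈ J := hs ▸ hy
        rw [show (⟨x + y, h⟩ : J) = ⟨x, hxJ⟩ + ⟨y, hyJ⟩ from rfl, map_add, smul_add, hx' hxJ,
          hy' hyJ, add_zero]
      | smul c x hx hx' =>
        intro h
        have hxJ : x ∈ J := hs ▸ hx
        rw [show (⟨c • x, h⟩ : J) = c • ⟨x, hxJ⟩ from rfl, map_smul, smul_comm, hx' hxJ,
          smul_zero]
    exact this j (hs ▸ hj) hj
  obtain ⟨k, hk⟩ := Ideal.exists_pow_inf_eq_pow_smul a J
  have hk1 := hk (k + 1) (Nat.le_succ k)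
  have hvan : ∀ j (hj : j ∈ J), j ∈ a ^ (k + 1) → f ⟨j, hj⟩ = 0 := by
    intro j hj hja
    have h1 : j ∈ a ^ (k + 1) • (⊤ : Submodule R R) ⊓ J := ⟨by simpa using hja, hj⟩
    rw [hk1, Nat.add_sub_cancel_left, pow_one] at h1
    have h2 : j ∈ a • J := Submodule.smul_mono le_rfl inf_le_right h1
    have : ∀ j ∈ a • J, ∀ hj : j ∈ J, f ⟨j, hj⟩ = 0 := by
      intro j hj
      induction hj using Submodule.smul_induction_on' with
      | smul r hr n hn =>
        intro h
        rw [show (⟨r • n, h⟩ : J) = r • ⟨n, hn⟩ from rfl, map_smul, haf r hr]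
      | add x hx y hy hx' hy' =>
        intro h
        have hxJ : x ∈ J := Submodule.smul_le_right hx
        have hyJ : y ∈ J := Submodule.smul_le_right hy
        rw [show (⟨x + y, h⟩ : J) = ⟨x, hxJ⟩ + ⟨y, hyJ⟩ from rfl, map_add, hx' hxJ,
          hy' hyJ, add_zero]
    exact this j h2 hj
  obtain ⟨g, hg⟩ := hE.exists_comp_eq_of_ker_le
    ((a ^ (k + 1)).mkQ ∘ₗ J.subtype) ((supportedSubmodule V E).subtype ∘ₗ f) (by
      rintro ⟨j, hj⟩ h
      have : j ∈ a ^ (k + 1) := by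
        exact (Submodule.Quotient.mk_eq_zero _).mp h
      simp [hvan j hj this])
  refine ⟨LinearMap.codRestrict _ (g ∘ₗ (a ^ (k + 1)).mkQ) fun r q hq => haV q ?_, ?_⟩
  · refine q.isPrime.le_of_pow_le (n := k + 1) (le_trans ?_ hq)
    intro b hb
    rw [Ideal.mem_torsionOf_iff, ← map_smul, LinearMap.comp_apply]
    have : (a ^ (k + 1)).mkQ (b • r) = 0 := by
      rw [Submodule.mkQ_apply, Submodule.Quotient.mk_eq_zero]
      exact Ideal.mul_mem_right _ _ hb
    rw [this, map_zero]
  · intro x hx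
    ext
    exact LinearMap.congr_fun hg ⟨x, hx⟩

end Support

section GorensteinInjective

variable {R : Type u} [CommRing R]

/-- Every doubly infinite exact sequence of injective modules is a complete injective
resolution. -/
def CompleteInjRes.ofExact (E : ℤ → Type u) [∀ i, AddCommGroup (E i)] [∀ i, Module R (E i)]
    (d : ∀ i, E i →ₗ[R] E (i + 1)) (inj : ∀ i, Module.Injective R (E i))
    (exct : ∀ i, LinearMap.range (d i) = LinearMap.ker (d (i + 1))) : CompleteInjRes R where
  E := E
  d := d
  inj := inj
  exct := exct
  homExact I _ _ hI i g hg := hI.exists_comp_eq_of_ker_le _ _ (by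
    rw [← exct]
    rintro _ ⟨x, rfl⟩
    exact LinearMap.congr_fun hg x)

theorem GorensteinInjective.of_linearEquiv {G G' : Type u} [AddCommGroup G] [Module R G]
    [AddCommGroup G'] [Module R G'] (hG : GorensteinInjective R G) (e : G' ≃ₗ[R] G) :
    GorensteinInjective R G' :=
  let ⟨X, ⟨f⟩⟩ := hG
  ⟨X, ⟨e.trans f⟩⟩

theorem CompleteInjRes.d_comp_d (X : CompleteInjRes R) (i : ℤ) (x : X.E i) :
    X.d (i + 1) (X.d i x) = 0 := by
  have : X.d i x ∈ LinearMap.range (X.d i) := ⟨x, rfl⟩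
  rwa [X.exct] at this

theorem CompleteInjRes.exists_of_d_eq_zero (X : CompleteInjRes R) (i : ℤ) (x : X.E (i + 1))
    (h : X.d (i + 1) x = 0) : ∃ y, X.d i y = x := by
  have : x ∈ LinearMap.ker (X.d (i + 1)) := h
  rwa [← X.exct] at this

theorem GorensteinInjective.exists_surjective {G : Type u} [AddCommGroup G] [Module R G]
    (hG : GorensteinInjective R G) :
    ∃ (E : Type u) (_ : AddCommGroup E) (_ : Module R E) (f : E →ₗ[R] G),
      Module.Injective R E ∧ Function.Surjective f := by
  obtain ⟨X, ⟨e⟩⟩ := hG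
  exact ⟨X.E 0, inferInstance, inferInstance, e.symm.toLinearMap ∘ₗ (X.d 0).rangeRestrict, X.inj 0,
    e.symm.surjective.comp (LinearMap.surjective_rangeRestrict _)⟩

variable [IsNoetherianRing R]

/-- The subcomplex of elements supported in `V`, provided that it is exact. -/
def CompleteInjRes.supportedOfExact (X : CompleteInjRes R) (V : Set (PrimeSpectrum R))
    (h : ∀ (i : ℤ) (z : X.E (i + 1)), z ∈ supportedSubmodule V (X.E (i + 1)) →
      X.d (i + 1) z = 0 → ∃ w ∈ supportedSubmodule V (X.E i), X.d i w = z) :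
    CompleteInjRes R :=
  .ofExact (fun i => supportedSubmodule V (X.E i)) (fun i => supportedMap V (X.d i))
    (fun i => supportedSubmodule_injective V (X.inj i)) (fun i => by
      ext z
      constructor
      · rintro ⟨y, rfl⟩
        exact Subtype.ext (X.d_comp_d i y)
      · intro hz
        obtain ⟨w, hw, hwz⟩ := h i z z.2 (congrArg Subtype.val hz)
        exact ⟨⟨w, hw⟩, Subtype.ext hwz⟩)

theorem CompleteInjRes.exists_lift_zeroLocus_singleton (X : CompleteInjRes R) (x : R) (i : ℤ)
    (z : X.E (i + 1)) (hz : z ∈ supportedSubmodule (PrimeSpectrum.zeroLocus {x}) (X.E (i + 1)))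
    (hdz : X.d (i + 1) z = 0) :
    ∃ w ∈ supportedSubmodule (PrimeSpectrum.zeroLocus {x}) (X.E i), X.d i w = z := by
  obtain ⟨j, rfl⟩ : ∃ j, i = j + 1 := ⟨i - 1, by ring⟩
  simp only [mem_supportedSubmodule_zeroLocus, Set.mem_singleton_iff, forall_eq] at hz ⊢
  obtain ⟨n, hn⟩ := hz
  obtain ⟨w, rfl⟩ := X.exists_of_d_eq_zero _ z hdz
  obtain ⟨v, hv⟩ := X.exists_of_d_eq_zero j (x ^ n • w) (by rw [map_smul, hn])
  obtain ⟨m, hm⟩ := (X.inj j).exists_pow_smul_eq x v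
  obtain ⟨v', hv'⟩ := hm n
  refine ⟨w - X.d j v', ⟨m + n, ?_⟩, ?_⟩
  · rw [smul_sub, ← map_smul, hv', map_smul, hv, smul_smul, pow_add, sub_self]
  · rw [map_sub, X.d_comp_d, sub_zero]

theorem CompleteInjRes.exists_lift_list (l : List R) : ∀ (X : CompleteInjRes R) (i : ℤ)
    (z : X.E (i + 1)), (∀ x ∈ l, ∃ n : ℕ, x ^ n • z = 0) → X.d (i + 1) z = 0 →
    ∃ w, X.d i w = z ∧ ∀ x ∈ l, ∃ n : ℕ, x ^ n • w = 0 := by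
  induction l with
  | nil =>
    intro X i z _ hdz
    obtain ⟨w, hw⟩ := X.exists_of_d_eq_zero i z hdz
    exact ⟨w, hw, by simp⟩
  | cons x l ih =>
    intro X i z hz hdz
    let Y := X.supportedOfExact _ (X.exists_lift_zeroLocus_singleton x)
    have hzx : z ∈ supportedSubmodule (PrimeSpectrum.zeroLocus {x}) (X.E (i + 1)) := by
      simpa [mem_supportedSubmodule_zeroLocus] using hz x (by simp)
    obtain ⟨w, hw, hwl⟩ := ih Y i ⟨z, hzx⟩ (fun y hy => by
      obtain ⟨n, hn⟩ := hz y (by simp [hy])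
      exact ⟨n, Subtype.ext hn⟩) (Subtype.ext hdz)
    refine ⟨w.1, congrArg Subtype.val hw, fun y hy => ?_⟩
    rcases List.mem_cons.mp hy with rfl | hy
    · simpa [mem_supportedSubmodule_zeroLocus] using w.2
    · obtain ⟨n, hn⟩ := hwl y hy
      exact ⟨n, congrArg Subtype.val hn⟩

theorem CompleteInjRes.exists_lift_supported (X : CompleteInjRes R) (V : Set (PrimeSpectrum R))
    (i : ℤ) (z : X.E (i + 1)) (hz : z ∈ supportedSubmodule V (X.E (i + 1)))
    (hdz : X.d (i + 1) z = 0) : ∃ w ∈ supportedSubmodule V (X.E i), X.d i w = z := by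
  obtain ⟨s, hs⟩ := IsNoetherian.noetherian (Ideal.torsionOf R _ z)
  obtain ⟨w, hw, hwl⟩ := CompleteInjRes.exists_lift_list s.toList X i z (fun x hx => by
    have : x ∈ Ideal.torsionOf R _ z := hs ▸ Submodule.subset_span (by simpa using hx)
    exact ⟨1, by simpa [Ideal.mem_torsionOf_iff] using this⟩) hdz
  refine ⟨w, fun q hq => hz q ?_, hw⟩
  rw [← hs, Submodule.span_le]
  intro x hx
  obtain ⟨n, hn⟩ := hwl x (by simpa using hx)
  exact q.isPrime.mem_of_pow_mem n (hq hn)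

/-- The subcomplex of elements supported in `V`. -/
def CompleteInjRes.supported (X : CompleteInjRes R) (V : Set (PrimeSpectrum R)) :
    CompleteInjRes R :=
  X.supportedOfExact V (X.exists_lift_supported V)

/-- The quotient of a complete injective resolution by the elements supported in `V`. -/
def CompleteInjRes.quotSupported (X : CompleteInjRes R) (V : Set (PrimeSpectrum R)) :
    CompleteInjRes R :=
  .ofExact (fun i => X.E i ⧸ supportedSubmodule V (X.E i))
    (fun i => Submodule.mapQ _ _ (X.d i) fun _ => map_mem_supportedSubmodule (X.d i))
    (fun i => (X.inj i).quotient _ (supportedSubmodule_injective V (X.inj i))) (fun i => by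
      ext z
      constructor
      · rintro ⟨y, rfl⟩
        obtain ⟨y, rfl⟩ := Submodule.Quotient.mk_surjective _ y
        simp [X.d_comp_d]
      · intro hz
        obtain ⟨z, rfl⟩ := Submodule.Quotient.mk_surjective _ z
        rw [LinearMap.mem_ker, Submodule.mapQ_apply, Submodule.Quotient.mk_eq_zero] at hz
        obtain ⟨w, hw, hwz⟩ := X.exists_lift_supported V _ _ hz (X.d_comp_d _ _)
        obtain ⟨y, hy⟩ := X.exists_of_d_eq_zero i (z - w) (by rw [map_sub, hwz, sub_self])
        refine ⟨Submodule.Quotient.mk y, ?_⟩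
        rw [Submodule.mapQ_apply, hy, Submodule.Quotient.eq]
        simpa using hw)

theorem GorensteinInjective.supportedSubmodule {G : Type u} [AddCommGroup G] [Module R G]
    (hG : GorensteinInjective R G) (V : Set (PrimeSpectrum R)) :
    GorensteinInjective R (supportedSubmodule V G) := by
  obtain ⟨X, ⟨e⟩⟩ := hG
  let f : _root_.supportedSubmodule V (LinearMap.range (X.d 0)) →ₗ[R] (X.supported V).E (0 + 1) :=
    supportedMap V (LinearMap.range (X.d 0)).subtype
  have hf : ∀ z, f z ∈ LinearMap.range ((X.supported V).d 0) := by
    rintro ⟨⟨z, y, rfl⟩, hz⟩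
    have hz' := (map_mem_supportedSubmodule_iff (LinearMap.range (X.d 0)).subtype
      (Submodule.injective_subtype _)).mpr hz
    obtain ⟨w, hw, hwz⟩ := X.exists_lift_supported V _ _ hz' (X.d_comp_d _ _)
    exact ⟨⟨w, hw⟩, Subtype.ext hwz⟩
  refine ⟨X.supported V, ⟨(supportedEquiv V e).trans (LinearEquiv.ofBijective
    (LinearMap.codRestrict (LinearMap.range ((X.supported V).d 0)) f hf) ⟨?_, ?_⟩)⟩⟩
  · intro a b h
    have := congrArg (fun t => (t.1.1 : X.E (0 + 1))) h
    exact Subtype.ext (Subtype.ext this)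
  · rintro ⟨_, ⟨y, hy⟩, rfl⟩
    refine ⟨⟨⟨X.d 0 y, y, rfl⟩, ?_⟩, rfl⟩
    exact (map_mem_supportedSubmodule_iff (LinearMap.range (X.d 0)).subtype
      (Submodule.injective_subtype _)).mp (map_mem_supportedSubmodule (X.d 0) hy)

theorem GorensteinInjective.quotSupported {G : Type u} [AddCommGroup G] [Module R G]
    (hG : GorensteinInjective R G) (V : Set (PrimeSpectrum R)) :
    GorensteinInjective R (G ⧸ _root_.supportedSubmodule V G) := by
  obtain ⟨X, ⟨e⟩⟩ := hG
  let f : G →ₗ[R] X.E (0 + 1) ⧸ _root_.supportedSubmodule V (X.E (0 + 1)) :=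
    (_root_.supportedSubmodule V (X.E (0 + 1))).mkQ ∘ₗ (LinearMap.range (X.d 0)).subtype ∘ₗ e.toLinearMap
  have hker : LinearMap.ker f = _root_.supportedSubmodule V G := by
    ext g
    rw [LinearMap.mem_ker, show f g = Submodule.Quotient.mk (e g).1 from rfl,
      Submodule.Quotient.mk_eq_zero]
    exact map_mem_supportedSubmodule_iff ((LinearMap.range (X.d 0)).subtype ∘ₗ e.toLinearMap)
      ((Submodule.injective_subtype _).comp e.injective)
  have hrange : LinearMap.range f = LinearMap.range ((X.quotSupported V).d 0) := by
    ext z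
    constructor
    · rintro ⟨g, rfl⟩
      obtain ⟨y, hy⟩ := (e g).2
      refine ⟨Submodule.Quotient.mk y, ?_⟩
      exact congrArg Submodule.Quotient.mk hy
    · rintro ⟨y, rfl⟩
      obtain ⟨y, rfl⟩ := Submodule.Quotient.mk_surjective _ y
      refine ⟨e.symm ⟨X.d 0 y, y, rfl⟩, ?_⟩
      simp only [f, LinearMap.comp_apply, LinearEquiv.coe_coe, LinearEquiv.apply_symm_apply]
      rfl
  exact ⟨X.quotSupported V, ⟨(Submodule.quotEquivOfEq _ _ hker.symm).trans
    (f.quotKerEquivRange.trans (LinearEquiv.ofEq _ _ hrange))⟩⟩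

end GorensteinInjective

section Localized

variable {R : Type u} [CommRing R]

theorem ker_mkLinearMap_eq_supportedSubmodule (S : Submonoid R) (M : Type u) [AddCommGroup M]
    [Module R M] : LinearMap.ker (LocalizedModule.mkLinearMap S M) =
      supportedSubmodule {q | ∃ s ∈ S, s ∈ q.asIdeal} M := by
  ext m
  rw [LinearMap.mem_ker, IsLocalizedModule.eq_zero_iff S, mem_supportedSubmodule]
  constructor
  · rintro ⟨s, hs⟩ q hq
    exact ⟨s, s.2, hq (by simpa [Ideal.mem_torsionOf_iff, Submonoid.smul_def] using hs)⟩
  · intro h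
    by_contra hcon
    have hd : Disjoint (Ideal.torsionOf R M m : Set R) S := by
      rw [Set.disjoint_left]
      intro s hs hsS
      exact hcon ⟨⟨s, hsS⟩, by simpa [Ideal.mem_torsionOf_iff] using hs⟩
    obtain ⟨q, hq, hle, hdisj⟩ := Ideal.exists_le_prime_disjoint _ _ hd
    obtain ⟨s, hs, hsq⟩ := h ⟨q, hq⟩ hle
    exact Set.disjoint_left.mp hdisj hsq hs

theorem mkLinearMap_surjective_of_injective [IsNoetherianRing R] (S : Submonoid R) {E : Type u}
    [AddCommGroup E] [Module R E] (hE : Module.Injective R E) :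
    Function.Surjective (LocalizedModule.mkLinearMap S E) := by
  intro z
  induction z using LocalizedModule.induction_on with
  | h y s =>
    obtain ⟨m, hm⟩ := hE.exists_pow_smul_eq s.1 y
    obtain ⟨z, hz⟩ := hm 1
    refine ⟨z, ?_⟩
    rw [LocalizedModule.mkLinearMap_apply, LocalizedModule.mk_eq]
    refine ⟨s ^ m, ?_⟩
    simp only [one_smul]
    rw [pow_add, pow_one, mul_smul] at hz
    exact hz

theorem GorensteinInjective.mkLinearMap_surjective [IsNoetherianRing R] (S : Submonoid R)
    {G : Type u} [AddCommGroup G] [Module R G] (hG : GorensteinInjective R G) :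
    Function.Surjective (LocalizedModule.mkLinearMap S G) := by
  obtain ⟨E, _, _, f, hE, hf⟩ := hG.exists_surjective
  intro z
  induction z using LocalizedModule.induction_on with
  | h y s =>
    obtain ⟨e, rfl⟩ := hf y
    obtain ⟨e', he'⟩ := mkLinearMap_surjective_of_injective S hE (LocalizedModule.mk e s)
    rw [LocalizedModule.mkLinearMap_apply, LocalizedModule.mk_eq] at he'
    obtain ⟨t, ht⟩ := he'
    refine ⟨f e', ?_⟩
    rw [LocalizedModule.mkLinearMap_apply, LocalizedModule.mk_eq]
    refine ⟨t, ?_⟩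
    have := congrArg f ht
    simpa [Submonoid.smul_def] using this

/-- Localizing is the same as dividing out torsion when the localization map is surjective. -/
noncomputable def quotSupportedEquivLocalizedModule (S : Submonoid R) {M : Type u} [AddCommGroup M]
    [Module R M] (h : Function.Surjective (LocalizedModule.mkLinearMap S M)) :
    (M ⧸ supportedSubmodule {q | ∃ s ∈ S, s ∈ q.asIdeal} M) ≃ₗ[R] LocalizedModule S M :=
  (Submodule.quotEquivOfEq _ _ (ker_mkLinearMap_eq_supportedSubmodule S M).symm).trans
    (LinearMap.quotKerEquivOfSurjective _ h)

theorem Module.Injective.localizedModule [IsNoetherianRing R] (S : Submonoid R) {E : Type u}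
    [AddCommGroup E] [Module R E] (hE : Module.Injective R E) :
    Module.Injective R (LocalizedModule S E) :=
  (hE.quotient _ (supportedSubmodule_injective _ hE)).of_linearEquiv
    (quotSupportedEquivLocalizedModule S (mkLinearMap_surjective_of_injective S hE)).symm

theorem GorensteinInjective.localizedModule [IsNoetherianRing R] (S : Submonoid R) {G : Type u}
    [AddCommGroup G] [Module R G] (hG : GorensteinInjective R G) :
    GorensteinInjective R (LocalizedModule S G) :=
  (hG.quotSupported _).of_linearEquiv
    (quotSupportedEquivLocalizedModule S (hG.mkLinearMap_surjective S)).symm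

end Localized

section LocalPart

variable {R : Type u} [CommRing R]

/-- `M` is a module over the localization of `R` at `p`. -/
def IsLocalAt (p : Ideal R) (M : Type u) [AddCommGroup M] [Module R M] : Prop :=
  ∀ r : R, r ∉ p → Function.Bijective (fun m : M => r • m)

theorem isLocalAt_localizedModule (p : Ideal R) [p.IsPrime] (M : Type u) [AddCommGroup M]
    [Module R M] : IsLocalAt p (LocalizedModule p.primeCompl M) := by
  intro r hr
  exact (Module.End.isUnit_iff _).mp
    (IsLocalizedModule.map_units (LocalizedModule.mkLinearMap p.primeCompl M) ⟨r, show r ∈ p.primeCompl from hr⟩)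

theorem IsLocalAt.of_linearEquiv {p : Ideal R} {M N : Type u} [AddCommGroup M] [Module R M]
    [AddCommGroup N] [Module R N] (h : IsLocalAt p M) (e : N ≃ₗ[R] M) : IsLocalAt p N := by
  intro r hr
  have : (fun m : N => r • m) = e.symm ∘ (fun m : M => r • m) ∘ e := by
    ext m
    simp
  rw [this]
  exact e.symm.bijective.comp ((h r hr).comp e.bijective)

theorem IsLocalAt.smul_eq_zero {p : Ideal R} {M : Type u} [AddCommGroup M] [Module R M]
    (h : IsLocalAt p M) {r : R} (hr : r ∉ p) {m : M} (hm : r • m = 0) : m = 0 :=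
  (h r hr).1 (by simpa using hm)

theorem IsLocalAt.supportedSubmodule {p : Ideal R} {M : Type u} [AddCommGroup M] [Module R M]
    (h : IsLocalAt p M) (V : Set (PrimeSpectrum R)) : IsLocalAt p (supportedSubmodule V M) := by
  intro r hr
  refine ⟨fun a b hab => Subtype.ext ((h r hr).1 (congrArg Subtype.val hab)), ?_⟩
  rintro ⟨m, hm⟩
  obtain ⟨y, hy⟩ := (h r hr).2 m
  refine ⟨⟨y, fun q hq => hm q (le_trans ?_ hq)⟩, Subtype.ext hy⟩
  intro a ha
  rw [Ideal.mem_torsionOf_iff] at ha ⊢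
  refine h.smul_eq_zero hr ?_
  rw [smul_comm, show r • y = m from hy, ha]

/-- Over a local module, an element whose annihilator has no prime above it strictly inside `p`
is `p`-torsion. -/
theorem IsLocalAt.mem_supportedSubmodule {p : Ideal R} [hp : p.IsPrime] {M : Type u}
    [AddCommGroup M] [Module R M] (h : IsLocalAt p M) {m : M}
    (hm : ∀ q : PrimeSpectrum R, q.asIdeal ≤ p → Ideal.torsionOf R M m ≤ q.asIdeal →
      p ≤ q.asIdeal) : m ∈ _root_.supportedSubmodule (PrimeSpectrum.zeroLocus (p : Set R)) M := by
  intro q hq a ha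
  by_contra haq
  let S : Submonoid R := Submonoid.powers a ⊔ p.primeCompl
  have hd : Disjoint (Ideal.torsionOf R M m : Set R) S := by
    rw [Set.disjoint_left]
    intro s hs hsS
    obtain ⟨_, ⟨n, rfl⟩, t, ht, rfl⟩ := Submonoid.mem_sup.mp hsS
    have hs' : (a ^ n * t) • m = 0 := hs
    rw [mul_comm, mul_smul] at hs'
    have := h.smul_eq_zero ht hs'
    exact haq (q.isPrime.mem_of_pow_mem n (hq this))
  obtain ⟨q', hq', hle, hdisj⟩ := Ideal.exists_le_prime_disjoint _ _ hd
  have hq'p : q' ≤ p := by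
    intro t ht
    by_contra htp
    exact Set.disjoint_left.mp hdisj ht (Submonoid.mem_sup_right (S := Submonoid.powers a)
      (T := p.primeCompl) htp)
  exact Set.disjoint_left.mp hdisj (hm ⟨q', hq'⟩ hq'p hle ha)
    (Submonoid.mem_sup_left (T := p.primeCompl) (Submonoid.mem_powers a))

theorem propT_of_isLocalAt [IsNoetherianRing R] {p : Ideal R} {M : Type u} [AddCommGroup M]
    [Module R M] (h : IsLocalAt p M) :
    PropT R p (supportedSubmodule (PrimeSpectrum.zeroLocus (p : Set R)) M) := by
  refine ⟨h.supportedSubmodule _, ?_⟩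
  rintro ⟨m, hm⟩
  have : p ≤ (Ideal.torsionOf R M m).radical := by
    intro a ha
    exact (mem_supportedSubmodule_zeroLocus _).mp hm a ha
  obtain ⟨n, hn⟩ := Ideal.exists_pow_le_of_le_radical_of_fg this (IsNoetherian.noetherian _)
  refine ⟨n + 1, Nat.succ_pos n, fun a ha => Subtype.ext ?_⟩
  exact hn (Ideal.pow_le_pow_right (Nat.le_succ n) ha)

theorem PropT.of_linearEquiv {p : Ideal R} {M N : Type u} [AddCommGroup M] [Module R M]
    [AddCommGroup N] [Module R N] (h : PropT R p M) (e : N ≃ₗ[R] M) : PropT R p N := by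
  refine ⟨IsLocalAt.of_linearEquiv h.1 e, fun x => ?_⟩
  obtain ⟨m, hm, hx⟩ := h.2 (e x)
  exact ⟨m, hm, fun a ha => e.injective (by rw [map_smul, hx a ha, map_zero])⟩

theorem mkLinearMap_eq_zero_iff (p : Ideal R) [hp : p.IsPrime] {M : Type u} [AddCommGroup M]
    [Module R M] (m : M) : LocalizedModule.mkLinearMap p.primeCompl M m = 0 ↔
      ¬ Ideal.torsionOf R M m ≤ p := by
  rw [IsLocalizedModule.eq_zero_iff p.primeCompl, SetLike.not_le_iff_exists]
  constructor
  · rintro ⟨s, hs⟩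
    exact ⟨s, hs, s.2⟩
  · rintro ⟨s, hs, hsp⟩
    exact ⟨⟨s, hsp⟩, hs⟩

theorem exists_torsionOf_mkLinearMap_le [IsNoetherianRing R] (S : Submonoid R) {M : Type u}
    [AddCommGroup M] [Module R M] (m : M) : ∃ t ∈ S,
      Ideal.torsionOf R _ (LocalizedModule.mkLinearMap S M m) ≤ Ideal.torsionOf R M (t • m) := by
  obtain ⟨s, hs⟩ := IsNoetherian.noetherian
    (Ideal.torsionOf R _ (LocalizedModule.mkLinearMap S M m))
  have : ∀ r ∈ s, ∃ t ∈ S, t • r • m = 0 := by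
    intro r hr
    have hr : r ∈ Ideal.torsionOf R _ (LocalizedModule.mkLinearMap S M m) :=
      hs ▸ Submodule.subset_span hr
    rw [Ideal.mem_torsionOf_iff, ← map_smul, IsLocalizedModule.eq_zero_iff S] at hr
    obtain ⟨t, ht⟩ := hr
    exact ⟨t, t.2, ht⟩
  choose! t htS ht using this
  refine ⟨∏ r ∈ s, t r, Submonoid.prod_mem _ htS, ?_⟩
  rw [← hs, Submodule.span_le]
  intro r hr
  obtain ⟨c, hc⟩ := Finset.dvd_prod_of_mem t hr
  rw [SetLike.mem_coe, Ideal.mem_torsionOf_iff, hc, smul_smul,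
    show r * (t r * c) = c * (t r * r) by ring, mul_smul, mul_smul, ht r hr, smul_zero]

/-- The `p`-torsion part of the localization of `M` at `p`. -/
abbrev LocalPart (p : PrimeSpectrum R) (M : Type u) [AddCommGroup M] [Module R M] : Type u :=
  supportedSubmodule (PrimeSpectrum.zeroLocus (p.asIdeal : Set R))
    (LocalizedModule p.asIdeal.primeCompl M)

theorem GorensteinInjective.localPart [IsNoetherianRing R] {G : Type u} [AddCommGroup G] [Module R G]
    (hG : GorensteinInjective R G) (p : PrimeSpectrum R) :
    GorensteinInjective R (LocalPart p G) :=
  (hG.localizedModule _).supportedSubmodule _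

theorem GorensteinInjective.exists_supported_lift [IsNoetherianRing R] {G : Type u} [AddCommGroup G] [Module R G]
    (hG : GorensteinInjective R G) (p : PrimeSpectrum R) (w : LocalPart p G) :
    ∃ x ∈ _root_.supportedSubmodule (PrimeSpectrum.zeroLocus (p.asIdeal : Set R)) G,
      LocalizedModule.mkLinearMap p.asIdeal.primeCompl G x = w := by
  obtain ⟨w, hw⟩ := w
  obtain ⟨g, rfl⟩ := hG.mkLinearMap_surjective p.asIdeal.primeCompl w
  obtain ⟨t, htp, ht⟩ := exists_torsionOf_mkLinearMap_le p.asIdeal.primeCompl g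
  have htg : t • g ∈ _root_.supportedSubmodule (PrimeSpectrum.zeroLocus (p.asIdeal : Set R)) G :=
    fun q hq => hw q (ht.trans hq)
  obtain ⟨x, hx⟩ := (hG.supportedSubmodule _).mkLinearMap_surjective p.asIdeal.primeCompl
    (LocalizedModule.mk ⟨t • g, htg⟩ ⟨t, htp⟩)
  refine ⟨x, x.2, ?_⟩
  rw [LocalizedModule.mkLinearMap_apply, LocalizedModule.mk_eq] at hx
  obtain ⟨c, hc⟩ := hx
  refine (isLocalAt_localizedModule p.asIdeal G c.1 c.2).1 ?_
  refine (isLocalAt_localizedModule p.asIdeal G t htp).1 ?_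
  have hc' := congrArg Subtype.val hc
  simp only [Submonoid.smul_def, one_smul] at hc'
  have := congrArg (LocalizedModule.mkLinearMap p.asIdeal.primeCompl G) hc'
  simp only [Submodule.coe_smul, map_smul] at this
  beta_reduce
  exact (smul_comm _ _ _).trans (this.trans (smul_comm _ _ _))

end LocalPart

section Filtration

variable {R : Type u} [CommRing R]

/-- The submodule of elements supported in height at least `k`. -/
abbrev heightFiltration (k : ℕ) (G : Type u) [AddCommGroup G] [Module R G] : Submodule R G :=
  supportedSubmodule {q | (k : ℕ∞) ≤ Order.height q} G

theorem eq_of_le_of_height_le {p q : PrimeSpectrum R} {k : ℕ} (hp : Order.height p = k)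
    (hqp : q ≤ p) (hq : (k : ℕ∞) ≤ Order.height q) : q = p := by
  by_contra hne
  have h1 : Order.height q < Order.height p := by
    refine Order.height_strictMono (lt_of_le_of_ne hqp hne) ?_
    exact lt_of_le_of_lt (Order.height_mono hqp) (by rw [hp]; exact ENat.natCast_lt_top k)
  rw [hp] at h1
  exact absurd h1 (not_lt.mpr hq)

theorem mkLinearMap_mem_localPart {G : Type u} [AddCommGroup G] [Module R G] {k : ℕ}
    {p : PrimeSpectrum R} (hp : Order.height p = k) {x : G} (hx : x ∈ heightFiltration (R := R) k G) :
    LocalizedModule.mkLinearMap p.asIdeal.primeCompl G x ∈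
      supportedSubmodule (PrimeSpectrum.zeroLocus (p.asIdeal : Set R))
        (LocalizedModule p.asIdeal.primeCompl G) := by
  refine (isLocalAt_localizedModule p.asIdeal G).mem_supportedSubmodule fun q hqp hq => ?_
  have := eq_of_le_of_height_le hp hqp (hx q ((torsionOf_le_torsionOf_map _ x).trans hq))
  rw [this]

/-- The localization maps at the primes of height `k`. -/
noncomputable def heightFiltrationMap (k : ℕ) (G : Type u) [AddCommGroup G] [Module R G] :
    heightFiltration (R := R) k G →ₗ[R]
      ∀ p : {p : PrimeSpectrum R // Order.height p = (k : ℕ∞)}, LocalPart p.1 G :=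
  LinearMap.pi fun p => (LocalizedModule.mkLinearMap p.1.asIdeal.primeCompl G).restrict
    fun _ hx => mkLinearMap_mem_localPart p.2 hx

theorem coe_heightFiltrationMap {k : ℕ} {G : Type u} [AddCommGroup G] [Module R G]
    (x : heightFiltration (R := R) k G)
    (p : {p : PrimeSpectrum R // Order.height p = (k : ℕ∞)}) :
    (heightFiltrationMap k G x p).1 = LocalizedModule.mkLinearMap p.1.asIdeal.primeCompl G x.1 :=
  rfl

theorem ker_heightFiltrationMap (k : ℕ) (G : Type u) [AddCommGroup G] [Module R G] :
    LinearMap.ker (heightFiltrationMap (R := R) k G) =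
      Submodule.comap (heightFiltration (R := R) k G).subtype (heightFiltration (R := R) (k + 1) G) := by
  ext ⟨x, hx⟩
  rw [LinearMap.mem_ker, Submodule.mem_comap]
  constructor
  · intro h q hq
    have hkq : (k : ℕ∞) ≤ Order.height q := hx q hq
    rcases eq_or_lt_of_le hkq with heq | hlt
    · have := congrArg Subtype.val (congrFun h ⟨q, heq.symm⟩)
      rw [coe_heightFiltrationMap] at this
      exact absurd hq ((mkLinearMap_eq_zero_iff q.asIdeal x).mp this)
    · simpa using Order.add_one_le_of_lt hlt
  · intro h
    funext p
    refine Subtype.ext ?_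
    rw [coe_heightFiltrationMap]
    refine (mkLinearMap_eq_zero_iff p.1.asIdeal x).mpr fun hle => ?_
    have := h p.1 hle
    rw [Set.mem_ofPred_eq, p.2] at this
    exact absurd (Nat.cast_le.mp this) (by omega)

variable [IsNoetherianRing R]

theorem GorensteinInjective.range_heightFiltrationMap {G : Type u} [AddCommGroup G] [Module R G]
    (hG : GorensteinInjective R G) (k : ℕ) :
    LinearMap.range (heightFiltrationMap (R := R) k G) = LinearMap.range (DFinsupp.coeFnLinearMap R :
      (⨁ p : {p : PrimeSpectrum R // Order.height p = (k : ℕ∞)}, LocalPart p.1 G) →ₗ[R] _) := by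
  classical
  refine le_antisymm ?_ ?_
  · rintro _ ⟨⟨x, hx⟩, rfl⟩
    have hfin : {p : {p : PrimeSpectrum R // Order.height p = (k : ℕ∞)} |
        heightFiltrationMap k G ⟨x, hx⟩ p ≠ 0}.Finite := by
      refine Set.Finite.of_finite_image (f := fun p => p.1.asIdeal)
        ((Ideal.finite_minimalPrimes_of_isNoetherianRing R (Ideal.torsionOf R G x)).subset ?_) ?_
      · rintro _ ⟨p, hp, rfl⟩
        have hle : Ideal.torsionOf R G x ≤ p.1.asIdeal := by
          by_contra hcon
          exact hp (Subtype.ext ((mkLinearMap_eq_zero_iff p.1.asIdeal x).mpr hcon))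
        refine ⟨⟨p.1.isPrime, hle⟩, ?_⟩
        rintro q ⟨hq, hxq⟩ hqp
        have := eq_of_le_of_height_le (q := ⟨q, hq⟩) p.2 hqp (hx ⟨q, hq⟩ hxq)
        exact (congrArg PrimeSpectrum.asIdeal this).ge
      · intro p _ q _ h
        exact Subtype.ext (PrimeSpectrum.ext h)
    refine ⟨DFinsupp.mk hfin.toFinset fun p => heightFiltrationMap k G ⟨x, hx⟩ p.1, ?_⟩
    funext p
    simp only [DFinsupp.coeFnLinearMap_apply, DFinsupp.mk_apply, Set.Finite.mem_toFinset,
      Set.mem_ofPred_eq]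
    split_ifs with h
    · rfl
    · simpa using Eq.symm (not_not.mp h)
  · rintro _ ⟨y, rfl⟩
    induction y using DirectSum.induction_on with
    | zero => rw [map_zero]; exact zero_mem _
    | add a b ha hb => rw [map_add]; exact add_mem ha hb
    | of p w =>
      obtain ⟨x, hx, hxw⟩ := hG.exists_supported_lift p.1 w
      have hxk : x ∈ heightFiltration (R := R) k G := by
        intro q hq
        have hpq : p.1 ≤ q := hx q hq
        have := Order.height_mono hpq
        rwa [p.2] at this
      refine ⟨⟨x, hxk⟩, ?_⟩
      funext q
      by_cases hqp : q = p
      · subst hqp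
        refine Subtype.ext ?_
        rw [coe_heightFiltrationMap, hxw, DFinsupp.coeFnLinearMap_apply]
        have h := DirectSum.of_eq_same (β := fun p : {p : PrimeSpectrum R //
          Order.height p = (k : ℕ∞)} => LocalPart p.1 G) q w
        exact congrArg Subtype.val h.symm
      · refine Subtype.ext ?_
        rw [coe_heightFiltrationMap, DFinsupp.coeFnLinearMap_apply]
        have h := DirectSum.of_eq_of_ne (β := fun p : {p : PrimeSpectrum R //
          Order.height p = (k : ℕ∞)} => LocalPart p.1 G) p q w hqp
        refine ((mkLinearMap_eq_zero_iff q.1.asIdeal x).mpr fun hle => hqp ?_).trans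
          (congrArg Subtype.val h.symm)
        have hpq : p.1 ≤ q.1 := hx q.1 hle
        exact Subtype.ext (eq_of_le_of_height_le q.2 hpq p.2.ge).symm

/-- The graded pieces of the height filtration are direct sums of local parts. -/
theorem GorensteinInjective.nonempty_heightFiltration_equiv {G : Type u} [AddCommGroup G]
    [Module R G] (hG : GorensteinInjective R G) (k : ℕ) :
    Nonempty ((heightFiltration (R := R) k G ⧸
      Submodule.comap (heightFiltration (R := R) k G).subtype (heightFiltration (R := R) (k + 1) G)) ≃ₗ[R]
      ⨁ p : {p : PrimeSpectrum R // Order.height p = (k : ℕ∞)}, LocalPart p.1 G) := by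
  refine ⟨(Submodule.quotEquivOfEq _ _ (ker_heightFiltrationMap k G).symm).trans
    ((heightFiltrationMap k G).quotKerEquivRange.trans
      ((LinearEquiv.ofEq _ _ (hG.range_heightFiltrationMap k)).trans
        (LinearEquiv.ofInjective _ ?_).symm))⟩
  exact DFunLike.coe_injective

theorem GorensteinInjective.heightFiltration_quotient {G : Type u} [AddCommGroup G]
    [Module R G] (hG : GorensteinInjective R G) (k : ℕ) :
    GorensteinInjective R (heightFiltration (R := R) k G ⧸
      Submodule.comap (heightFiltration (R := R) k G).subtype (heightFiltration (R := R) (k + 1) G)) := by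
  refine ((hG.supportedSubmodule _).quotSupported
    {q | ((k + 1 : ℕ) : ℕ∞) ≤ Order.height q}).of_linearEquiv (Submodule.quotEquivOfEq _ _ ?_)
  ext x
  exact map_mem_supportedSubmodule_iff (m := x) (heightFiltration (R := R) k G).subtype
    (Submodule.injective_subtype _)

/-- The filtration of a Gorenstein injective module by height of support. -/
theorem GorensteinInjective.exists_filtration {d : ℕ}
    (hd : ringKrullDim R = ((d : ℕ∞) : WithBot ℕ∞)) {G : Type u} [AddCommGroup G] [Module R G]
    (hG : GorensteinInjective R G) (T : ℕ → PrimeSpectrum R → Type u)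
    [∀ k p, AddCommGroup (T k p)] [∀ k p, Module R (T k p)]
    (hT : ∀ (k : ℕ) (p : PrimeSpectrum R), Order.height p = k →
      Nonempty (T k p ≃ₗ[R] LocalPart p G)) :
    ∃ Gsub : Fin (d + 2) → Submodule R G,
      Antitone Gsub ∧ Gsub 0 = ⊤ ∧ Gsub (Fin.last (d + 1)) = ⊥ ∧
      (∀ k : Fin (d + 2), GorensteinInjective R ↥(Gsub k)) ∧
      (∀ k : Fin (d + 1),
        GorensteinInjective R
          (↥(Gsub k.castSucc) ⧸
            Submodule.comap (Gsub k.castSucc).subtype (Gsub k.succ)) ∧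
        Nonempty ((↥(Gsub k.castSucc) ⧸
            Submodule.comap (Gsub k.castSucc).subtype (Gsub k.succ)) ≃ₗ[R]
          (⨁ p : {p : PrimeSpectrum R // Order.height p = ((k : ℕ) : ℕ∞)}, T (k : ℕ) p.1))) := by
  refine ⟨fun k => heightFiltration (R := R) k G, ?_, ?_, ?_, fun k => hG.supportedSubmodule _,
    fun k => ⟨hG.heightFiltration_quotient k, ?_⟩⟩
  · intro a b hab x hx q hq
    have : ((a : ℕ) : ℕ∞) ≤ (b : ℕ) := by exact_mod_cast hab
    exact this.trans (hx q hq)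
  · refine eq_top_iff.mpr fun x _ q _ => ?_
    simp
  · refine eq_bot_iff.mpr fun x hx => ?_
    by_contra hne
    obtain ⟨q, hq, hle⟩ := Ideal.exists_le_maximal (Ideal.torsionOf R G x)
      (fun h => hne (by simpa using h))
    have h1 : ((d + 1 : ℕ) : ℕ∞) ≤ Order.height (⟨q, hq.isPrime⟩ : PrimeSpectrum R) :=
      hx ⟨q, hq.isPrime⟩ hle
    have h2 := Order.height_le_krullDim (⟨q, hq.isPrime⟩ : PrimeSpectrum R)
    rw [show Order.krullDim (PrimeSpectrum R) = _ from hd] at h2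
    have h3 := h1.trans (WithBot.coe_le_coe.mp h2)
    exact absurd (Nat.cast_le.mp h3) (by omega)
  · obtain ⟨e⟩ := hG.nonempty_heightFiltration_equiv (k : ℕ)
    have hT' : ∀ p : {p : PrimeSpectrum R // Order.height p = ((k : ℕ) : ℕ∞)},
      Nonempty (T k p.1 ≃ₗ[R] LocalPart p.1 G) := fun p => hT k p.1 p.2
    exact ⟨e.trans (DFinsupp.mapRange.linearEquiv fun p => (hT' p).some.symm)⟩

end Filtration

section RegularSequences

variable {R : Type u} [CommRing R]

/-- The list `K`, read from its last entry to its first, becomes a regular sequence in the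
localization at `p`. -/
def IsRegularAt (p : Ideal R) : List R → Prop
  | [] => True
  | x :: K => IsRegularAt p K ∧ x ∈ p ∧
      ∀ a, a * x ∈ Ideal.ofList K → ∃ s ∉ p, s * a ∈ Ideal.ofList K

theorem IsRegularAt.ofList_le {p : Ideal R} : ∀ {K : List R}, IsRegularAt p K →
    Ideal.ofList K ≤ p
  | [], _ => by simp
  | x :: K, h => by
    rw [Ideal.ofList_cons, sup_le_iff, Ideal.span_singleton_le_iff_mem]
    exact ⟨h.2.1, h.1.ofList_le⟩

theorem exists_isRegularAt_of_isWeaklyRegular (p : Ideal R) [p.IsPrime]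
    (rs : List (Localization.AtPrime p))
    (hrs : ∀ r ∈ rs, r ∈ IsLocalRing.maximalIdeal (Localization.AtPrime p))
    (hreg : RingTheory.Sequence.IsWeaklyRegular (Localization.AtPrime p) rs) :
    ∃ K : List R, IsRegularAt p K ∧ K.length = rs.length ∧
      (Ideal.ofList K).map (algebraMap R (Localization.AtPrime p)) = Ideal.ofList rs := by
  induction rs using List.reverseRecOn with
  | nil => exact ⟨[], trivial, rfl, by simp⟩
  | append_singleton rs r ih =>
    rw [RingTheory.Sequence.isWeaklyRegular_append_iff,
      RingTheory.Sequence.isWeaklyRegular_singleton_iff,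
      isSMulRegular_quotient_iff_mem_of_smul_mem] at hreg
    obtain ⟨K, hK, hlen, hmap⟩ := ih (fun r' hr' => hrs r' (by simp [hr'])) hreg.1
    obtain ⟨x, s, rfl⟩ := IsLocalization.exists_mk'_eq p.primeCompl r
    have hunit : IsUnit (algebraMap R (Localization.AtPrime p) s) :=
      IsLocalization.map_units _ s
    have hx := IsLocalization.mk'_spec' (Localization.AtPrime p) x s
    refine ⟨x :: K, ⟨hK, ?_, fun a ha => ?_⟩, by simp [hlen], ?_⟩
    · have h1 := hrs (IsLocalization.mk' _ x s) (by simp)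
      rw [IsLocalization.AtPrime.mk'_mem_maximal_iff _ p] at h1
      exact h1
    · have h1 : algebraMap R (Localization.AtPrime p) (a * x) ∈ Ideal.ofList rs :=
        hmap ▸ Ideal.mem_map_of_mem _ ha
      have h2 : algebraMap R (Localization.AtPrime p) a ∈ Ideal.ofList rs := by
        have := hreg.2 (algebraMap R (Localization.AtPrime p) a) (by
          rw [smul_eq_mul, Ideal.mul_top, smul_eq_mul]
          rw [map_mul, ← hx, mul_left_comm, Ideal.unit_mul_mem_iff_mem _ hunit, mul_comm] at h1
          exact h1)
        rwa [smul_eq_mul, Ideal.mul_top] at this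
      rw [← hmap, IsLocalization.algebraMap_mem_map_algebraMap_iff p.primeCompl] at h2
      obtain ⟨t, ht, hta⟩ := h2
      exact ⟨t, ht, hta⟩
    · rw [Ideal.ofList_cons, Ideal.map_sup, hmap, Ideal.ofList_append, sup_comm,
        Ideal.ofList_singleton, Ideal.map_span, Set.image_singleton, ← hx,
        Ideal.span_singleton_mul_left_unit hunit]

theorem IsCohenMacaulayRing.exists_isRegularAt (hCM : IsCohenMacaulayRing R)
    (p : PrimeSpectrum R) {k : ℕ} (hk : Order.height p = k) :
    ∃ K : List R, IsRegularAt p.asIdeal K ∧ K.length = k := by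
  have h := hCM p.asIdeal p.isPrime
  rw [IsLocalization.AtPrime.ringKrullDim_eq_height p.asIdeal,
    PrimeSpectrum.height_eq_orderHeight, hk] at h
  have h' : localRingDepth (Localization.AtPrime p.asIdeal) = k := WithBot.coe_injective h
  unfold localRingDepth at h'
  set T := {n : ℕ∞ | ∃ rs : List (Localization.AtPrime p.asIdeal),
    (∀ r ∈ rs, r ∈ IsLocalRing.maximalIdeal (Localization.AtPrime p.asIdeal)) ∧
    RingTheory.Sequence.IsRegular (Localization.AtPrime p.asIdeal) rs ∧ (rs.length : ℕ∞) = n}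
  have : Nonempty T :=
    ⟨⟨0, [], by simp, RingTheory.Sequence.IsRegular.nil _ _, by simp⟩⟩
  have hmem : sSup T ∈ T :=
    ENat.sSup_mem_of_nonempty_of_lt_top (by rw [h']; exact ENat.natCast_lt_top k)
  obtain ⟨rs, hrs, hreg, hlen⟩ := hmem
  obtain ⟨K, hK, hKlen, -⟩ :=
    exists_isRegularAt_of_isWeaklyRegular p.asIdeal rs hrs hreg.toIsWeaklyRegular
  refine ⟨K, hK, ?_⟩
  rw [h', Nat.cast_inj] at hlen
  omega

variable [IsNoetherianRing R]

theorem exists_mem_iff_mul_mem_of_mem_minimalPrimes {I p : Ideal R} (hp : p ∈ I.minimalPrimes) :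
    ∃ y, ∀ a, a ∈ p ↔ a * y ∈ I := by
  have hI : (I : Submodule R R).colon {1} = I := by
    ext a
    simp [Submodule.mem_colon_singleton]
  obtain ⟨y, hy⟩ := Submodule.exists_eq_colon_of_mem_minimalPrimes (N := I) (x := 1)
    (by rwa [hI])
  refine ⟨y, fun a => ?_⟩
  rw [hy, Submodule.mem_colon_singleton, smul_eq_mul]

theorem IsRegularAt.length_le_height {p : Ideal R} : ∀ {K : List R}, IsRegularAt p K →
    ∀ q : PrimeSpectrum R, q.asIdeal ≤ p → Ideal.ofList K ≤ q.asIdeal →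
      (K.length : ℕ∞) ≤ Order.height q
  | [], _, q, _, _ => by simp
  | x :: K, h, q, hqp, hq => by
    rw [Ideal.ofList_cons, sup_le_iff, Ideal.span_singleton_le_iff_mem] at hq
    have := q.isPrime
    obtain ⟨q', hq', hle⟩ := Ideal.exists_minimalPrimes_le hq.2
    have ih := h.1.length_le_height ⟨q', hq'.1.1⟩ (hle.trans hqp) hq'.1.2
    have hx : x ∉ q' := by
      intro hx
      obtain ⟨y, hy⟩ := exists_mem_iff_mul_mem_of_mem_minimalPrimes hq'
      obtain ⟨s, hs, hsy⟩ := h.2.2 y (by rw [mul_comm]; exact (hy x).mp hx)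
      exact hs (hqp (hle ((hy s).mpr hsy)))
    have hlt : (⟨q', hq'.1.1⟩ : PrimeSpectrum R) < q :=
      lt_of_le_of_ne hle fun h => hx (by
        rw [show q' = q.asIdeal from congrArg PrimeSpectrum.asIdeal h]
        exact hq.1)
    rw [List.length_cons, Nat.cast_add, Nat.cast_one]
    exact (add_le_add_left ih 1).trans (Order.height_add_one_le hlt)

theorem IsRegularAt.mem_minimalPrimes {p : PrimeSpectrum R} {K : List R}
    (h : IsRegularAt p.asIdeal K) (hk : Order.height p = K.length) :
    p.asIdeal ∈ (Ideal.ofList K).minimalPrimes := by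
  refine ⟨⟨p.isPrime, h.ofList_le⟩, ?_⟩
  rintro q ⟨hq, hKq⟩ hqp
  have := eq_of_le_of_height_le (q := ⟨q, hq⟩) hk hqp (h.length_le_height _ hqp hKq)
  exact (congrArg PrimeSpectrum.asIdeal this).ge

end RegularSequences

section CechStep

variable {R : Type u} [CommRing R]

/-- Every element of `M` is annihilated by powers of the elements of `K`. -/
def IsTorsionBy (K : List R) (M : Type u) [AddCommGroup M] [Module R M] : Prop :=
  ∀ m : M, ∀ k ∈ K, ∃ n : ℕ, k ^ n • m = 0

/-- The list `K`, read from its last entry to its first, is a coregular sequence on `M`. -/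
def IsCoregular : List R → ∀ (M : Type u) [AddCommGroup M] [Module R M], Prop
  | [], _, _, _ => True
  | x :: K, M, _, _ => IsCoregular K M ∧
      ∀ m : M, (∀ k ∈ K, k • m = 0) → ∃ m' : M, (∀ k ∈ K, k • m' = 0) ∧ x • m' = m

/-- The elements of `H` annihilated by `K` form, locally at `p`, a module isomorphic to
`R ⧸ Ideal.ofList K`. -/
def IsSocleCyclic (p : Ideal R) (K : List R) (H : Type u) [AddCommGroup H] [Module R H] : Prop :=
  ∃ e : H, (∀ k ∈ K, k • e = 0) ∧
    (∀ h : H, (∀ k ∈ K, k • h = 0) → ∃ s ∉ p, ∃ a : R, s • h = a • e) ∧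
    ∀ a : R, a • e = 0 → ∃ s ∉ p, s * a ∈ Ideal.ofList K

/-- A short exact sequence `0 → M → L → M' → 0` in which the first map is the localization at the
powers of `x`. -/
structure IsCechStep (x : R) {M L M' : Type u} [AddCommGroup M] [Module R M] [AddCommGroup L]
    [Module R L] [AddCommGroup M'] [Module R M'] (f : M →ₗ[R] L) (g : L →ₗ[R] M') : Prop where
  injective : Function.Injective f
  bijective : Function.Bijective (fun l : L => x • l)
  exists_pow : ∀ l : L, ∃ (n : ℕ) (m : M), x ^ n • l = f m
  surjective : Function.Surjective g
  exact : Function.Exact f g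

variable {x : R} {M L M' : Type u} [AddCommGroup M] [Module R M] [AddCommGroup L]
    [Module R L] [AddCommGroup M'] [Module R M'] {f : M →ₗ[R] L} {g : L →ₗ[R] M'}

theorem IsCechStep.pow_bijective (h : IsCechStep x f g) (n : ℕ) :
    Function.Bijective (fun l : L => x ^ n • l) := by
  induction n with
  | zero =>
    simp only [pow_zero, one_smul]
    exact Function.bijective_id
  | succ n ih =>
    have : (fun l : L => x ^ (n + 1) • l) = (fun l : L => x ^ n • l) ∘ fun l => x • l := by
      ext l
      simp [pow_succ, mul_smul]
    rw [this]
    exact ih.comp h.bijective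

theorem IsCechStep.isTorsionBy (h : IsCechStep x f g) {K : List R} (hM : IsTorsionBy K M) :
    IsTorsionBy (x :: K) M' := by
  intro y k hk
  obtain ⟨l, rfl⟩ := h.surjective y
  obtain ⟨n, m, hn⟩ := h.exists_pow l
  rcases List.mem_cons.mp hk with rfl | hk
  · exact ⟨n, by rw [← map_smul, hn, h.exact.apply_apply_eq_zero]⟩
  · obtain ⟨N, hN⟩ := hM m k hk
    refine ⟨N, ?_⟩
    rw [← map_smul, show k ^ N • l = 0 from (h.pow_bijective n).1 ?_, map_zero]
    simp only [smul_zero]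
    rw [smul_comm, hn, ← map_smul, hN, map_zero]

theorem IsCoregular.exists_lift {K : List R} (hM : IsCoregular K M) (hf : Function.Injective f)
    (hg : Function.Surjective g) (hfg : Function.Exact f g) (y : M') (hy : ∀ k ∈ K, k • y = 0) :
    ∃ l : L, (∀ k ∈ K, k • l = 0) ∧ g l = y := by
  induction K with
  | nil =>
    obtain ⟨l, rfl⟩ := hg y
    exact ⟨l, by simp, rfl⟩
  | cons x K ih =>
    obtain ⟨l, hl, rfl⟩ := ih hM.1 fun k hk => hy k (List.mem_cons_of_mem _ hk)
    obtain ⟨m, hm⟩ := (hfg (x • l)).mp (by rw [map_smul]; exact hy x List.mem_cons_self)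
    obtain ⟨m', hm', rfl⟩ := hM.2 m fun k hk => hf (by
      rw [map_smul, hm, smul_comm, hl k hk, smul_zero, map_zero])
    refine ⟨l - f m', fun k hk => ?_, by simp [hfg.apply_apply_eq_zero]⟩
    rcases List.mem_cons.mp hk with rfl | hk
    · rw [smul_sub, ← map_smul, hm, sub_self]
    · rw [smul_sub, hl k hk, ← map_smul, hm' k hk, map_zero, sub_zero]

theorem IsCoregular.quotient {K : List R} (hM : IsCoregular K M) (hL : IsCoregular K L)
    (hf : Function.Injective f) (hg : Function.Surjective g) (hfg : Function.Exact f g) :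
    IsCoregular K M' := by
  induction K with
  | nil => trivial
  | cons x K ih =>
    refine ⟨ih hM.1 hL.1, fun y hy => ?_⟩
    obtain ⟨l, hl, rfl⟩ := hM.1.exists_lift hf hg hfg y hy
    obtain ⟨l', hl', rfl⟩ := hL.2 l hl
    exact ⟨g l', fun k hk => by rw [← map_smul, hl' k hk, map_zero], by rw [map_smul]⟩

theorem IsCechStep.isCoregular_localization (h : IsCechStep x f g) {K : List R}
    (hM : IsCoregular K M) : IsCoregular K L := by
  induction K with
  | nil => trivial
  | cons k K ih =>
    refine ⟨ih hM.1, fun l hl => ?_⟩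
    obtain ⟨n, m, hn⟩ := h.exists_pow l
    obtain ⟨m', hm', rfl⟩ := hM.2 m fun k hk => h.injective (by
      rw [map_smul, ← hn, smul_comm, hl k hk, smul_zero, map_zero])
    obtain ⟨l', hl'⟩ := (h.pow_bijective n).2 (f m')
    have hl' : x ^ n • l' = f m' := hl'
    refine ⟨l', fun k hk => (h.pow_bijective n).1 ?_, (h.pow_bijective n).1 ?_⟩
    · simp only [smul_zero]
      rw [smul_comm, hl', ← map_smul, hm' k hk, map_zero]
    · beta_reduce
      rw [smul_comm, hl', ← map_smul, hn]

theorem IsCechStep.isCoregular (h : IsCechStep x f g) {K : List R} (hM : IsCoregular K M) :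
    IsCoregular (x :: K) M' := by
  have hL := h.isCoregular_localization hM
  refine ⟨hM.quotient hL h.injective h.surjective h.exact, fun y hy => ?_⟩
  obtain ⟨l, hl, rfl⟩ := hM.exists_lift h.injective h.surjective h.exact y hy
  obtain ⟨l', rfl⟩ := h.bijective.2 l
  refine ⟨g l', fun k hk => ?_, by rw [map_smul]⟩
  rw [← map_smul, show k • l' = 0 from h.bijective.1 ?_, map_zero]
  simp only [smul_zero]
  rw [smul_comm]
  exact hl k hk

theorem smul_eq_zero_of_mem_ofList {K : List R} {m : M} (hm : ∀ k ∈ K, k • m = 0) {a : R}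
    (ha : a ∈ Ideal.ofList K) : a • m = 0 := by
  have : Ideal.ofList K ≤ Ideal.torsionOf R M m :=
    Ideal.span_le.mpr fun k hk => hm k hk
  exact this ha

theorem IsCechStep.isSocleCyclic (h : IsCechStep x f g) {p : Ideal R} [hp : p.IsPrime]
    {K : List R} (hM : IsCoregular K M) (hs : IsSocleCyclic p K M) :
    IsSocleCyclic p (x :: K) M' := by
  obtain ⟨e, heK, hgen, hann⟩ := hs
  obtain ⟨l, hl⟩ := h.bijective.2 (f e)
  have hl : x • l = f e := hl
  refine ⟨g l, fun k hk => ?_, fun y hy => ?_, fun a ha => ?_⟩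
  · rcases List.mem_cons.mp hk with rfl | hk
    · rw [← map_smul, hl, h.exact.apply_apply_eq_zero]
    · rw [← map_smul, show k • l = 0 from h.bijective.1 ?_, map_zero]
      simp only [smul_zero]
      rw [smul_comm, hl, ← map_smul, heK k hk, map_zero]
  · obtain ⟨l', hl', rfl⟩ := hM.exists_lift h.injective h.surjective h.exact y
      fun k hk => hy k (List.mem_cons_of_mem _ hk)
    obtain ⟨m, hm⟩ := (h.exact (x • l')).mp (by rw [map_smul]; exact hy x List.mem_cons_self)
    obtain ⟨s, hsp, a, hsa⟩ := hgen m fun k hk => h.injective (by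
      rw [map_smul, hm, smul_comm, hl' k hk, smul_zero, map_zero])
    refine ⟨s, hsp, a, ?_⟩
    rw [← map_smul, ← map_smul, show s • l' = a • l from h.bijective.1 ?_]
    beta_reduce
    rw [smul_comm, ← hm, ← map_smul, hsa, smul_comm x a, hl, map_smul]
  · rw [← map_smul] at ha
    obtain ⟨m, hm⟩ := (h.exact (a • l)).mp ha
    have hx : a • e = x • m := h.injective (by
      rw [map_smul, map_smul, hm, ← hl, smul_comm])
    obtain ⟨s, hsp, b, hsb⟩ := hgen m fun k hk => h.injective (by
      rw [map_smul, hm, map_zero]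
      refine h.bijective.1 ?_
      simp only [smul_zero]
      rw [smul_comm x, smul_comm x, hl, ← map_smul, ← map_smul, smul_comm, heK k hk, smul_zero,
        map_zero])
    obtain ⟨t, htp, ht⟩ := hann (s * a - x * b) (by
      rw [sub_smul, mul_smul, mul_smul, hx, ← hsb, smul_comm, sub_self])
    refine ⟨t * s, fun hts => (hp.mem_or_mem hts).elim htp hsp, ?_⟩
    rw [Ideal.ofList_cons, show t * s * a = x * (t * b) + t * (s * a - x * b) by ring]
    exact add_mem (Submodule.mem_sup_left
      (Ideal.mul_mem_right _ _ (Ideal.mem_span_singleton_self x))) (Submodule.mem_sup_right ht)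

theorem IsTorsionBy.exists_smul_ne_zero {K : List R} {m : M}
    (h : ∀ k ∈ K, ∃ n : ℕ, k ^ n • m = 0) (hm : m ≠ 0) :
    ∃ c : R, c • m ≠ 0 ∧ ∀ k ∈ K, k • c • m = 0 := by
  classical
  induction K with
  | nil => exact ⟨1, by simpa using hm, by simp⟩
  | cons x K ih =>
    obtain ⟨c, hc, hcK⟩ := ih fun k hk => h k (List.mem_cons_of_mem _ hk)
    have hex : ∃ n : ℕ, x ^ n • c • m = 0 := by
      obtain ⟨n, hn⟩ := h x List.mem_cons_self
      exact ⟨n, by rw [smul_comm, hn, smul_zero]⟩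
    have hpos : Nat.find hex ≠ 0 := fun h0 => hc (by
      have := Nat.find_spec hex
      rwa [h0, pow_zero, one_smul] at this)
    obtain ⟨n, hn⟩ := Nat.exists_eq_succ_of_ne_zero hpos
    refine ⟨x ^ n * c, ?_, fun k hk => ?_⟩
    · rw [mul_smul]
      exact Nat.find_min hex (by omega)
    · rw [mul_smul]
      rcases List.mem_cons.mp hk with rfl | hk
      · rw [smul_smul, ← pow_succ', ← Nat.succ_eq_add_one, ← hn]
        exact Nat.find_spec hex
      · rw [smul_comm, hcK k hk, smul_zero]

theorem IsSocleCyclic.smul_injective {p : Ideal R} [p.IsPrime] {K : List R}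
    (hs : IsSocleCyclic p K M) (hM : IsTorsionBy K M) (hloc : IsLocalAt p M)
    (hreg : IsRegularAt p (x :: K)) (m : M) (hm : x • m = 0) : m = 0 := by
  by_contra hne
  obtain ⟨e, heK, hgen, hann⟩ := hs
  obtain ⟨c, hc, hcK⟩ := IsTorsionBy.exists_smul_ne_zero (hM m) hne
  obtain ⟨s, hsp, a, hsa⟩ := hgen _ hcK
  obtain ⟨t, htp, ht⟩ := hann (x * a) (by
    rw [mul_smul, ← hsa, smul_comm x s, smul_comm x c, hm, smul_zero, smul_zero])
  obtain ⟨v, hvp, hv⟩ := hreg.2.2 (t * a) (by rwa [show t * a * x = t * (x * a) by ring])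
  have h1 := smul_eq_zero_of_mem_ofList heK hv
  rw [mul_smul, mul_smul, ← hsa] at h1
  exact hc (hloc.smul_eq_zero hsp (hloc.smul_eq_zero htp (hloc.smul_eq_zero hvp h1)))

end CechStep

section MinimalPrime

variable {R : Type u} [CommRing R] {p : Ideal R} {K : List R}

theorem Module.Injective.isCoregular {I : Type u} [AddCommGroup I] [Module R I]
    (hI : Module.Injective R I) (hloc : IsLocalAt p I) (hK : IsRegularAt p K) :
    IsCoregular K I := by
  induction K with
  | nil => trivial
  | cons x K ih =>
    refine ⟨ih hK.1, fun m hm => ?_⟩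
    obtain ⟨g, hg⟩ := hI.exists_comp_eq_of_ker_le
      ((Ideal.ofList K).mkQ ∘ₗ LinearMap.toSpanSingleton R R x)
      (LinearMap.toSpanSingleton R I m) (fun a ha => by
        simp only [LinearMap.mem_ker, LinearMap.comp_apply, LinearMap.toSpanSingleton_apply,
          Submodule.mkQ_apply, Submodule.Quotient.mk_eq_zero, smul_eq_mul] at ha ⊢
        obtain ⟨s, hsp, hs⟩ := hK.2.2 a ha
        refine hloc.smul_eq_zero hsp ?_
        rw [← mul_smul]
        exact smul_eq_zero_of_mem_ofList hm hs)
    refine ⟨g ((Ideal.ofList K).mkQ 1), fun k hk => ?_, ?_⟩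
    · have hk' : k ∈ Ideal.ofList K := Ideal.subset_span hk
      rw [← map_smul, ← map_smul, smul_eq_mul, mul_one, Submodule.mkQ_apply,
        (Submodule.Quotient.mk_eq_zero (Ideal.ofList K)).mpr hk', map_zero]
    · have := LinearMap.congr_fun hg 1
      simp only [LinearMap.comp_apply, LinearMap.toSpanSingleton_apply, one_smul] at this
      rw [← map_smul, ← map_smul, smul_eq_mul, mul_one, this]

variable {M I C : Type u} [AddCommGroup M] [Module R M] [AddCommGroup I] [Module R I]
  [AddCommGroup C] [Module R C]

theorem Module.Injective.of_exact (hI : Module.Injective R I) (hC : Module.Injective R C)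
    {f : M →ₗ[R] I} {g : I →ₗ[R] C} (hf : Function.Injective f)
    (hfg : Function.Exact f g) (hloc : IsLocalAt p C)
    (hsoc : ∀ c : C, c ≠ 0 → ∃ a : R, a • c ≠ 0 ∧ ∀ b ∈ p, b • a • c = 0)
    (hlift : ∀ c : C, (∀ b ∈ p, b • c = 0) → ∃ i : I, (∀ b ∈ p, b • i = 0) ∧ g i = c) :
    Module.Injective R M := by
  obtain ⟨N, -, hN⟩ := zorn_le_nonempty₀ {N : Submodule R I | Disjoint N (LinearMap.range f)}
    (fun c hc hchain N hNc => ⟨sSup c,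
      (hchain.directedOn.disjoint_sSup_left).mpr fun N hN => hc hN, fun N hN => le_sSup hN⟩)
    ⊥ disjoint_bot_left
  have hNd : Disjoint N (LinearMap.range f) := hN.1
  have hNinj : ∀ n ∈ N, g n = 0 → n = 0 := fun n hn hgn =>
    Submodule.disjoint_def.mp hNd n hn ((hfg n).mp hgn)
  have hess : ∀ c : C, c ≠ 0 → ∃ a : R, a • c ≠ 0 ∧ ∃ n ∈ N, g n = a • c := by
    intro c hc
    obtain ⟨a, hac, hpa⟩ := hsoc c hc
    obtain ⟨i, hpi, hi⟩ := hlift _ hpa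
    by_cases hiN : i ∈ N
    · exact ⟨a, hac, i, hiN, hi⟩
    have hnd : ¬ Disjoint (N ⊔ R ∙ i) (LinearMap.range f) := fun hd =>
      hiN (hN.2 (y := N ⊔ R ∙ i) hd le_sup_left
        (Submodule.mem_sup_right (Submodule.mem_span_singleton_self i)))
    rw [Submodule.disjoint_def] at hnd
    push Not at hnd
    obtain ⟨z, hz, hzf, hz0⟩ := hnd
    obtain ⟨n, hn, w, hw, rfl⟩ := Submodule.mem_sup.mp hz
    obtain ⟨b, rfl⟩ := Submodule.mem_span_singleton.mp hw
    have hbp : b ∉ p := fun hbp => hz0 (by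
      rw [hpi b hbp, add_zero] at hzf ⊢
      exact Submodule.disjoint_def.mp hNd n hn hzf)
    have hg0 : g (n + b • i) = 0 := (hfg _).mpr hzf
    rw [map_add, map_smul, hi] at hg0
    refine ⟨b * a, fun h => hac (hloc.smul_eq_zero hbp (by rw [← mul_smul, h])), -n,
      N.neg_mem hn, ?_⟩
    rw [map_neg, mul_smul, ← neg_eq_of_add_eq_zero_right hg0]
  obtain ⟨σ, hσ⟩ := hI.exists_comp_eq_of_ker_le (g ∘ₗ N.subtype) N.subtype (fun n hn => by
    exact hNinj n n.2 hn)
  have hσN : ∀ n ∈ N, σ (g n) = n := fun n hn => LinearMap.congr_fun hσ ⟨n, hn⟩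
  obtain ⟨r, hr⟩ := hC.exists_comp_eq_of_ker_le (g ∘ₗ σ) LinearMap.id (fun c hc => by
    by_contra hc0
    obtain ⟨a, hac, n, hn, hgn⟩ := hess c hc0
    apply hac
    rw [← hgn, ← hσN n hn, hgn, map_smul, map_smul, show g (σ c) = 0 from hc, smul_zero])
  have hr' : ∀ c, r (g (σ c)) = c := fun c => LinearMap.congr_fun hr c
  have hrinj : ∀ c, r c = 0 → c = 0 := fun c hc => by
    by_contra hc0
    obtain ⟨a, hac, n, hn, hgn⟩ := hess c hc0
    apply hac
    rw [← hr' (a • c), ← hgn, hσN n hn, hgn, map_smul, hc, smul_zero]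
  have hsec : ∀ c, g (σ (r c)) = c := fun c => by
    rw [← sub_eq_zero]
    exact hrinj _ (by rw [map_sub, hr', sub_self])
  let ρ : I →ₗ[R] LinearMap.range f := (LinearMap.id - σ ∘ₗ r ∘ₗ g).codRestrict _ fun i =>
    (hfg _).mp (by simp [hsec])
  refine hI.of_retract f ((LinearEquiv.ofInjective f hf).symm.toLinearMap ∘ₗ ρ) ?_
  ext m
  have : ρ (f m) = LinearEquiv.ofInjective f hf m := by
    ext
    change f m - σ (r (g (f m))) = f m
    rw [hfg.apply_apply_eq_zero, map_zero, map_zero, sub_zero]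
  simp [this]

theorem IsLocalAt.quotient (hI : IsLocalAt p I) (hM : IsLocalAt p M)
    {f : M →ₗ[R] I} {g : I →ₗ[R] C} (hg : Function.Surjective g)
    (hfg : Function.Exact f g) : IsLocalAt p C := by
  intro r hr
  refine ⟨(injective_iff_map_eq_zero (LinearMap.lsmul R C r)).mpr fun c hc => ?_, fun c => ?_⟩
  · obtain ⟨i, rfl⟩ := hg c
    have hc : r • g i = 0 := hc
    rw [← map_smul] at hc
    obtain ⟨m, hm⟩ := (hfg _).mp hc
    obtain ⟨m', rfl⟩ := (hM r hr).2 m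
    have : i = f m' := (hI r hr).1 (by simp only [← hm, map_smul])
    rw [this, hfg.apply_apply_eq_zero]
  · obtain ⟨i, rfl⟩ := hg c
    obtain ⟨i', rfl⟩ := (hI r hr).2 i
    exact ⟨g i', by simp⟩

end MinimalPrime

section InjectiveOfFiniteDimension

variable {R : Type u} [CommRing R] [IsNoetherianRing R] {p : Ideal R} {K : List R}

theorem IsLocalAt.supportedSubmodule_eq (hp : p ∈ (Ideal.ofList K).minimalPrimes)
    {N : Type u} [AddCommGroup N] [Module R N] (hN : IsLocalAt p N) :
    _root_.supportedSubmodule (PrimeSpectrum.zeroLocus {k | k ∈ K}) N =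
      _root_.supportedSubmodule (PrimeSpectrum.zeroLocus (p : Set R)) N := by
  have := hp.1.1
  have hKp : ∀ k ∈ K, k ∈ p := fun k hk => hp.1.2 (Ideal.subset_span hk)
  refine le_antisymm (fun m hm => hN.mem_supportedSubmodule fun q hqp hq => ?_) fun m hm => ?_
  · exact hp.2 ⟨q.isPrime, Ideal.span_le.mpr (hm q hq)⟩ hqp
  · rw [mem_supportedSubmodule_zeroLocus] at hm ⊢
    exact fun x hx => hm x (hKp x hx)

theorem exists_smul_ne_zero_of_mem_minimalPrimes (hp : p ∈ (Ideal.ofList K).minimalPrimes)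
    {C : Type u} [AddCommGroup C] [Module R C] (hloc : IsLocalAt p C) (hC : IsTorsionBy K C)
    {c : C} (hc : c ≠ 0) : ∃ a : R, a • c ≠ 0 ∧ ∀ b ∈ p, b • a • c = 0 := by
  have hm : c ∈ supportedSubmodule (PrimeSpectrum.zeroLocus {k | k ∈ K}) C :=
    (mem_supportedSubmodule_zeroLocus _).mpr (hC c)
  rw [hloc.supportedSubmodule_eq hp, mem_supportedSubmodule_zeroLocus] at hm
  obtain ⟨s, hs⟩ := IsNoetherian.noetherian p
  have hs' : Ideal.ofList s.toList = p := by
    rw [← hs, Ideal.ofList]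
    simp
  obtain ⟨a, hac, ha⟩ := IsTorsionBy.exists_smul_ne_zero (K := s.toList) (m := c)
    (fun k hk => hm k (hs' ▸ Ideal.subset_span hk)) hc
  exact ⟨a, hac, fun b hb => smul_eq_zero_of_mem_ofList ha (by rwa [hs'])⟩

theorem exists_injective_embedding (R : Type u) [CommRing R] (M : Type u) [AddCommGroup M]
    [Module R M] : ∃ J : ModuleCat.{u} R, Module.Injective R J ∧
      ∃ f : M →ₗ[R] J, Function.Injective f :=
  ⟨Injective.under (ModuleCat.of R M),
    (Module.injective_iff_injective_object R _).mpr
      (Injective.injective_under (ModuleCat.of R M)),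
    (Injective.ι (ModuleCat.of R M)).hom,
    (ModuleCat.mono_iff_injective _).mp inferInstance⟩

theorem IsLocalAt.exists_injective_embedding [p.IsPrime] {M : Type u} [AddCommGroup M]
    [Module R M] (hloc : IsLocalAt p M) (hM : IsTorsionBy K M) :
    ∃ I : ModuleCat.{u} R, Module.Injective R I ∧ IsLocalAt p I ∧ IsTorsionBy K I ∧
      ∃ f : M →ₗ[R] I, Function.Injective f := by
  obtain ⟨J, hJ, f, hf⟩ := _root_.exists_injective_embedding R M
  have hJp := Module.Injective.localizedModule p.primeCompl hJ
  let V : Set (PrimeSpectrum R) := PrimeSpectrum.zeroLocus {k | k ∈ K}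
  have hfV : ∀ m, (LocalizedModule.mkLinearMap p.primeCompl J ∘ₗ f) m ∈
      _root_.supportedSubmodule V (LocalizedModule p.primeCompl J) := fun m =>
    map_mem_supportedSubmodule _ ((mem_supportedSubmodule_zeroLocus _).mpr (hM m))
  refine ⟨ModuleCat.of R (_root_.supportedSubmodule V (LocalizedModule p.primeCompl J)),
    supportedSubmodule_injective V hJp, (isLocalAt_localizedModule p J).supportedSubmodule V,
    fun m k hk => ?_, LinearMap.codRestrict _ _ hfV, ?_⟩
  · obtain ⟨n, hn⟩ := (mem_supportedSubmodule_zeroLocus _).mp m.2 k hk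
    exact ⟨n, Subtype.ext hn⟩
  · rw [injective_iff_map_eq_zero]
    intro m hm
    have hm' : LocalizedModule.mkLinearMap p.primeCompl J (f m) = 0 := congrArg Subtype.val hm
    rw [IsLocalizedModule.eq_zero_iff p.primeCompl] at hm'
    obtain ⟨s, hs⟩ := hm'
    exact hloc.smul_eq_zero s.2 (hf (by rw [map_smul, map_zero]; exact hs))

theorem injective_of_hasInjectiveDimensionLT (hp : p ∈ (Ideal.ofList K).minimalPrimes)
    (hK : IsRegularAt p K) (n : ℕ) (M : ModuleCat.{u} R) (hloc : IsLocalAt p M)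
    (htors : IsTorsionBy K M) (hcor : IsCoregular K M)
    (hn : HasInjectiveDimensionLT M (n + 1)) : Module.Injective R M := by
  have := hp.1.1
  induction n generalizing M with
  | zero =>
    exact (Module.injective_iff_injective_object R M).mpr
      (injective_iff_hasInjectiveDimensionLT_one.mpr hn)
  | succ n ih =>
    obtain ⟨I, hI, hIloc, hItors, f, hf⟩ := hloc.exists_injective_embedding htors
    let g := (LinearMap.range f).mkQ
    have hg : Function.Surjective g := Submodule.mkQ_surjective _
    have hfg : Function.Exact f g := LinearMap.exact_map_mkQ_range f
    have hIcor := hI.isCoregular hIloc hK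
    have hCloc : IsLocalAt p (I ⧸ LinearMap.range f) := hIloc.quotient hloc hg hfg
    have hCtors : IsTorsionBy K (I ⧸ LinearMap.range f) := fun c k hk => by
      obtain ⟨i, rfl⟩ := hg c
      obtain ⟨n, hn⟩ := hItors i k hk
      exact ⟨n, by rw [← map_smul, hn, map_zero]⟩
    have hCcor : IsCoregular K (I ⧸ LinearMap.range f) := hcor.quotient hIcor hf hg hfg
    let S : ShortComplex (ModuleCat.{u} R) := ShortComplex.mk (ModuleCat.ofHom f)
      (ModuleCat.ofHom g) (by ext m; exact hfg.apply_apply_eq_zero m)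
    have hS : S.ShortExact :=
      { exact := (ShortComplex.ShortExact.moduleCat_exact_iff_function_exact S).mpr hfg
        mono_f := (ModuleCat.mono_iff_injective _).mpr hf
        epi_g := (ModuleCat.epi_iff_surjective _).mpr hg }
    have hIinj : Injective S.X₂ := (Module.injective_iff_injective_object R I).mp hI
    have hC := ih S.X₃ hCloc hCtors hCcor ((hS.hasInjectiveDimensionLT_X₃_iff n hIinj).mpr hn)
    refine hI.of_exact (C := I ⧸ LinearMap.range f) (p := p) hC hf hfg hCloc
      (fun c hc => exists_smul_ne_zero_of_mem_minimalPrimes hp hCloc hCtors hc) fun c hc => ?_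
    obtain ⟨y, hy⟩ := exists_mem_iff_mul_mem_of_mem_minimalPrimes hp
    obtain ⟨h, hh⟩ := hC.exists_comp_eq_of_ker_le
      ((Ideal.ofList K).mkQ ∘ₗ LinearMap.toSpanSingleton R R y)
      (LinearMap.toSpanSingleton R (I ⧸ LinearMap.range f) c) (fun a ha => by
        simp only [LinearMap.mem_ker, LinearMap.comp_apply, LinearMap.toSpanSingleton_apply,
          Submodule.mkQ_apply, Submodule.Quotient.mk_eq_zero, smul_eq_mul] at ha ⊢
        exact hc a ((hy a).mpr ha))
    obtain ⟨i, hi, hic⟩ := hcor.exists_lift hf hg hfg (h ((Ideal.ofList K).mkQ 1))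
      fun k hk => by
        have hk' : k ∈ Ideal.ofList K := Ideal.subset_span hk
        rw [← map_smul, ← map_smul, smul_eq_mul, mul_one, Submodule.mkQ_apply,
          (Submodule.Quotient.mk_eq_zero (Ideal.ofList K)).mpr hk', map_zero]
    refine ⟨y • i, fun b hb => ?_, ?_⟩
    · rw [← mul_smul]
      exact smul_eq_zero_of_mem_ofList hi ((hy b).mp hb)
    · have := LinearMap.congr_fun hh 1
      simp only [LinearMap.comp_apply, LinearMap.toSpanSingleton_apply, one_smul] at this
      rw [map_smul, hic, ← map_smul, ← map_smul, smul_eq_mul, mul_one, this]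

end InjectiveOfFiniteDimension

section Hull

variable {R : Type u} [CommRing R] {D : Type u} [AddCommGroup D] [Module R D]
  {M : Type u} [AddCommGroup M] [Module R M]

theorem IsTorsionBy.linearMap [Module.Finite R D] {K : List R} (hM : IsTorsionBy K M) :
    IsTorsionBy K (D →ₗ[R] M) := by
  intro φ k hk
  obtain ⟨s, hs⟩ := Module.Finite.fg_top (R := R) (M := D)
  choose n hn using fun d => hM (φ d) k hk
  refine ⟨∑ d ∈ s, n d, LinearMap.ext_on hs fun d hd => ?_⟩
  obtain ⟨c, hc⟩ := Nat.exists_eq_add_of_le (Finset.single_le_sum (f := n)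
    (fun _ _ => Nat.zero_le _) hd)
  rw [LinearMap.smul_apply, hc, add_comm, pow_add, mul_smul, hn, smul_zero, LinearMap.zero_apply]

theorem IsLocalAt.linearMap {p : Ideal R} (hM : IsLocalAt p M) : IsLocalAt p (D →ₗ[R] M) := by
  intro r hr
  refine ⟨fun φ ψ h => LinearMap.ext fun d => (hM r hr).1 (LinearMap.congr_fun h d), fun φ => ?_⟩
  let e : M ≃ₗ[R] M := LinearEquiv.ofBijective (LinearMap.lsmul R M r) (hM r hr)
  refine ⟨e.symm.toLinearMap ∘ₗ φ, LinearMap.ext fun d => ?_⟩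
  exact e.apply_symm_apply (φ d)

theorem exists_linearMap_ne_zero [IsNoetherianRing R] [Module.Finite R D]
    (hD : Module.annihilator R D = ⊥) [Nontrivial M] : ∃ φ : D →ₗ[R] M, φ ≠ 0 := by
  obtain ⟨m, hm⟩ := exists_ne (0 : M)
  have : ¬ Subsingleton (D →ₗ[R] R ∙ m) := by
    rw [IsSMulRegular.subsingleton_linearMap_iff]
    rintro ⟨r, hr, hreg⟩
    rw [hD, Submodule.mem_bot] at hr
    subst hr
    exact hm (congrArg Subtype.val (hreg (a₁ := ⟨m, Submodule.mem_span_singleton_self m⟩)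
      (a₂ := 0) (by simp)))
  rw [not_subsingleton_iff_nontrivial] at this
  obtain ⟨φ, hφ⟩ := exists_ne (0 : D →ₗ[R] R ∙ m)
  refine ⟨(R ∙ m).subtype ∘ₗ φ, fun h => hφ (LinearMap.ext fun d => Subtype.ext ?_)⟩
  exact LinearMap.congr_fun h d

theorem exists_linearMap_ne_zero_of_isTorsionBy [IsNoetherianRing R] [Module.Finite R D]
    (hD : Module.annihilator R D = ⊥) {K : List R} (hM : IsTorsionBy K M) (N : Submodule R M)
    (hN : N ≠ ⊥) : ∃ φ : D →ₗ[R] M, φ ≠ 0 ∧ (∀ k ∈ K, k • φ = 0) ∧ ∀ d, φ d ∈ N := by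
  have := Submodule.nontrivial_iff_ne_bot.mpr hN
  obtain ⟨φ, hφ⟩ := exists_linearMap_ne_zero (M := N) hD
  have hφ' : N.subtype ∘ₗ φ ≠ 0 := fun h => hφ (LinearMap.ext fun d => Subtype.ext
    (LinearMap.congr_fun h d))
  obtain ⟨c, hc, hcK⟩ := IsTorsionBy.exists_smul_ne_zero (hM.linearMap (N.subtype ∘ₗ φ)) hφ'
  exact ⟨_, hc, hcK, fun d => N.smul_mem c (φ d).2⟩

theorem IsSocleCyclic.nonempty_equiv [IsNoetherianRing R] [Module.Finite R D]
    (hD : Module.annihilator R D = ⊥) {p : Ideal R} {K : List R}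
    (hp : p ∈ (Ideal.ofList K).minimalPrimes) (hs : IsSocleCyclic p K (D →ₗ[R] M))
    (hinj : Module.Injective R M) (hloc : IsLocalAt p M) (htors : IsTorsionBy K M)
    {E : Type u} [AddCommGroup E] [Module R E] (hE : IsInjectiveHull R (R ⧸ p) E) :
    Nonempty (M ≃ₗ[R] E) := by
  have := hp.1.1
  obtain ⟨e, heK, hgen, hann⟩ := hs
  have hne : Nontrivial M := by
    by_contra h
    rw [not_nontrivial_iff_subsingleton] at h
    obtain ⟨s, hsp, hs⟩ := hann 1 (Subsingleton.elim _ _)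
    exact hsp (hp.1.2 (by rwa [mul_one] at hs))
  obtain ⟨m, hm⟩ := exists_ne (0 : M)
  obtain ⟨a, ham, hpa⟩ := exists_smul_ne_zero_of_mem_minimalPrimes hp hloc htors hm
  obtain ⟨hEinj, ι, hι, hess⟩ := hE
  let v : (R ⧸ p) →ₗ[R] M := Submodule.liftQ p (LinearMap.toSpanSingleton R M (a • m)) hpa
  have hv : ∀ z, v z = 0 → z = 0 := by
    intro z hz
    obtain ⟨r, rfl⟩ := Submodule.mkQ_surjective p z
    by_contra hr
    have hr : r ∉ p := fun h => hr ((Submodule.Quotient.mk_eq_zero p).mpr h)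
    exact ham (hloc.smul_eq_zero hr hz)
  obtain ⟨ψ, hψ⟩ := hinj.exists_comp_eq_of_ker_le ι v (fun z hz => by
    rw [hι (hz.trans (map_zero ι).symm), LinearMap.mem_ker, map_zero])
  have hψker : LinearMap.ker ψ = ⊥ := by
    by_contra h
    refine hess _ h ((Submodule.eq_bot_iff _).mpr ?_)
    rintro _ ⟨hz, z, rfl⟩
    rw [hv z (by rw [← hψ]; exact hz), map_zero]
  obtain ⟨r, hr⟩ := hEinj.exists_comp_eq_of_ker_le ψ LinearMap.id (by rw [hψker]; exact bot_le)
  have hr' : ∀ z, r (ψ z) = z := fun z => LinearMap.congr_fun hr z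
  have hH : IsLocalAt p (D →ₗ[R] M) := hloc.linearMap
  let P : (D →ₗ[R] M) →ₗ[R] (D →ₗ[R] M) := LinearMap.llcomp R D M M (ψ ∘ₗ r)
  have hP : ∀ φ d, P φ d = ψ (r (φ d)) := fun φ d => rfl
  have hPP : ∀ φ, P (P φ) = P φ := fun φ => LinearMap.ext fun d => by simp [hP, hr']
  obtain ⟨s, hsp, b, hsb⟩ := hgen (P e) fun k hk => by rw [← map_smul, heK k hk, map_zero]
  have hb : b ∉ p := by
    intro hb
    have hPe : P e = 0 := by
      refine hH.smul_eq_zero (r := s - b) (fun h => hsp (by simpa using add_mem h hb)) ?_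
      rw [sub_smul, sub_eq_zero]
      have := congrArg P hsb
      rwa [map_smul, map_smul, hPP] at this
    obtain ⟨φ, hφ0, hφK, hφ⟩ := exists_linearMap_ne_zero_of_isTorsionBy hD htors
      (LinearMap.range ψ) (fun h => ham (by
        have : v (p.mkQ 1) ∈ LinearMap.range ψ := ⟨ι (p.mkQ 1), by rw [← hψ]; rfl⟩
        rw [h, Submodule.mem_bot] at this
        change (1 : R) • a • m = 0 at this
        rwa [one_smul] at this))
    have hPφ : P φ = φ := LinearMap.ext fun d => by
      obtain ⟨z, hz⟩ := hφ d
      rw [hP, ← hz, hr']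
    obtain ⟨t, htp, c, htc⟩ := hgen φ hφK
    apply hφ0
    rw [← hPφ]
    refine hH.smul_eq_zero htp ?_
    rw [← map_smul, htc, map_smul, hPe, smul_zero]
  have hPe : P e = e := by
    rw [← sub_eq_zero, ← neg_eq_zero, neg_sub]
    refine hH.smul_eq_zero hb ?_
    have := congrArg P hsb
    rw [map_smul, map_smul, hPP, hsb] at this
    rw [smul_sub, this, sub_self]
  have hker : LinearMap.ker r = ⊥ := by
    by_contra h
    obtain ⟨φ, hφ0, hφK, hφ⟩ := exists_linearMap_ne_zero_of_isTorsionBy (D := D) hD htors _ h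
    have hPφ : P φ = 0 := LinearMap.ext fun d => by
      rw [hP, show r (φ d) = 0 from hφ d, map_zero, LinearMap.zero_apply]
    obtain ⟨t, htp, c, htc⟩ := hgen φ hφK
    apply hφ0
    refine hH.smul_eq_zero htp ?_
    rw [htc, ← hPe, ← map_smul, ← htc, map_smul, hPφ, smul_zero]
  exact ⟨LinearEquiv.ofBijective r ⟨LinearMap.ker_eq_bot.mp hker, fun z => ⟨ψ z, hr' z⟩⟩⟩

end Hull

section ExtLocalization

variable {R : Type u} [CommRing R]

theorem moduleCat_shortExact {A B C : Type u} [AddCommGroup A] [Module R A] [AddCommGroup B]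
    [Module R B] [AddCommGroup C] [Module R C] {f : A →ₗ[R] B} {g : B →ₗ[R] C}
    (hf : Function.Injective f) (hg : Function.Surjective g) (hfg : Function.Exact f g) :
    (ShortComplex.mk (ModuleCat.ofHom f) (ModuleCat.ofHom g)
      (by ext m; exact hfg.apply_apply_eq_zero m)).ShortExact where
  exact := (ShortComplex.ShortExact.moduleCat_exact_iff_function_exact _).mpr hfg
  mono_f := (ModuleCat.mono_iff_injective _).mpr hf
  epi_g := (ModuleCat.epi_iff_surjective _).mpr hg

/-- The groups `Ext_R^i(D, M)` vanish for `i ≥ 1`. -/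
def ExtVanish (D M : Type u) [AddCommGroup D] [Module R D] [AddCommGroup M] [Module R M] : Prop :=
  ∀ (n : ℕ) (e : Abelian.Ext (ModuleCat.of R D) (ModuleCat.of R M) (n + 1)), e = 0

theorem extVanish_of_subsingleton_extM {D M : Type u} [AddCommGroup D] [Module R D]
    [AddCommGroup M] [Module R M] (h : ∀ i : ℕ, 1 ≤ i → Subsingleton (ExtM R i D M)) :
    ExtVanish (R := R) D M := by
  intro n e
  let P := projectiveResolution (ModuleCat.of R D)
  obtain ⟨f, hf, rfl⟩ := P.extMk_surjective e (n + 2) rfl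
  rw [P.extMk_eq_zero_iff f (n + 2) rfl hf n rfl]
  have h0 : IsZero (ExtM R (n + 1) D M) :=
    ModuleCat.isZero_iff_subsingleton.mpr (h (n + 1) (Nat.le_add_left 1 n))
  have h1 := h0.of_iso (P.isoExt (n + 1) (ModuleCat.of R M)).symm
  rw [← HomologicalComplex.exactAt_iff_isZero_homology,
    HomologicalComplex.exactAt_iff' _ n (n + 1) (n + 2) (by simp) (by simp),
    ShortComplex.moduleCat_exact_iff] at h1
  exact h1 f hf

theorem ext_one_eq_zero_iff {A B C : Type u} [AddCommGroup A] [Module R A] [AddCommGroup B]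
    [Module R B] [AddCommGroup C] [Module R C] [Module.Projective R B]
    {f : A →ₗ[R] B} {g : B →ₗ[R] C}
    (hf : Function.Injective f) (hg : Function.Surjective g) (hfg : Function.Exact f g)
    (M : Type u) [AddCommGroup M] [Module R M] :
    (∀ e : Abelian.Ext (ModuleCat.of R C) (ModuleCat.of R M) 1, e = 0) ↔
      ∀ φ : A →ₗ[R] M, ∃ ψ : B →ₗ[R] M, ψ ∘ₗ f = φ := by
  have hS := moduleCat_shortExact hf hg hfg
  have : Projective (ModuleCat.of R B) := inferInstance
  constructor
  · intro h φ
    obtain ⟨x, hx⟩ := Abelian.Ext.contravariant_sequence_exact₁ hS (ModuleCat.of R M)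
      (Abelian.Ext.mk₀ (ModuleCat.ofHom φ)) (add_zero 1) (h _)
    obtain ⟨ψ, rfl⟩ := (Abelian.Ext.mk₀_bijective _ _).2 x
    rw [Abelian.Ext.mk₀_comp_mk₀] at hx
    have := (Abelian.Ext.mk₀_bijective _ _).1 hx
    exact ⟨ψ.hom, congrArg ModuleCat.Hom.hom this⟩
  · intro h e
    obtain ⟨x, rfl⟩ := Abelian.Ext.contravariant_sequence_exact₃ hS (ModuleCat.of R M) e
      (Abelian.Ext.eq_zero_of_projective (P := ModuleCat.of R B) _) (add_zero 1)
    obtain ⟨φ, rfl⟩ := (Abelian.Ext.mk₀_bijective _ _).2 x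
    obtain ⟨ψ, hψ⟩ := h φ.hom
    have : φ = ModuleCat.ofHom f ≫ ModuleCat.ofHom ψ := by
      ext m
      exact (LinearMap.congr_fun hψ m).symm
    rw [this, ← Abelian.Ext.mk₀_comp_mk₀, ← Abelian.Ext.comp_assoc_of_second_deg_zero,
      hS.extClass_comp, Abelian.Ext.zero_comp]

theorem ext_succ_eq_zero_iff {A B C : Type u} [AddCommGroup A] [Module R A] [AddCommGroup B]
    [Module R B] [AddCommGroup C] [Module R C] [Module.Projective R B]
    {f : A →ₗ[R] B} {g : B →ₗ[R] C}
    (hf : Function.Injective f) (hg : Function.Surjective g) (hfg : Function.Exact f g)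
    (M : Type u) [AddCommGroup M] [Module R M] (n : ℕ) :
    (∀ e : Abelian.Ext (ModuleCat.of R C) (ModuleCat.of R M) (n + 2), e = 0) ↔
      ∀ e : Abelian.Ext (ModuleCat.of R A) (ModuleCat.of R M) (n + 1), e = 0 := by
  have hS := moduleCat_shortExact hf hg hfg
  have : Projective (ModuleCat.of R B) := inferInstance
  constructor
  · intro h e
    obtain ⟨x, rfl⟩ := Abelian.Ext.contravariant_sequence_exact₁ hS (ModuleCat.of R M)
      e (show 1 + (n + 1) = n + 2 by omega) (h _)
    rw [Abelian.Ext.eq_zero_of_projective (P := ModuleCat.of R B) x, Abelian.Ext.comp_zero]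
  · intro h e
    obtain ⟨x, rfl⟩ := Abelian.Ext.contravariant_sequence_exact₃ hS (ModuleCat.of R M) e
      (Abelian.Ext.eq_zero_of_projective (P := ModuleCat.of R B) _)
      (show 1 + (n + 1) = n + 2 by omega)
    rw [h x, Abelian.Ext.comp_zero]

theorem ext_eq_zero_of_isLocalizedModule [IsNoetherianRing R] (S : Submonoid R) {M L : Type u}
    [AddCommGroup M] [Module R M] [AddCommGroup L] [Module R L] (ℓ : M →ₗ[R] L)
    [IsLocalizedModule S ℓ] (n : ℕ) (D : Type u) [AddCommGroup D] [Module R D]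
    [Module.Finite R D]
    (h : ∀ e : Abelian.Ext (ModuleCat.of R D) (ModuleCat.of R M) (n + 1), e = 0)
    (e : Abelian.Ext (ModuleCat.of R D) (ModuleCat.of R L) (n + 1)) : e = 0 := by
  induction n generalizing D with
  | zero =>
    obtain ⟨m, π, hπ⟩ := Module.Finite.exists_fin' R D
    have hf : Function.Injective (LinearMap.ker π).subtype := Subtype.val_injective
    have hfg : Function.Exact (LinearMap.ker π).subtype π := LinearMap.exact_subtype_ker_map π
    revert e
    rw [zero_add] at h ⊢
    have h := (ext_one_eq_zero_iff hf hπ hfg M).mp h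
    rw [ext_one_eq_zero_iff hf hπ hfg L]
    intro φ
    have : Module.Finite R (LinearMap.ker π) := Module.IsNoetherian.finite R _
    have := Module.finitePresentation_of_finite R (LinearMap.ker π)
    obtain ⟨φ', s, hs⟩ := Module.FinitePresentation.exists_lift_of_isLocalizedModule S ℓ φ
    obtain ⟨ψ, rfl⟩ := h φ'
    have hu := (Module.End.isUnit_iff _).mp (IsLocalizedModule.map_units ℓ s)
    let u : L ≃ₗ[R] L := LinearEquiv.ofBijective _ hu
    refine ⟨u.symm.toLinearMap ∘ₗ ℓ ∘ₗ ψ, LinearMap.ext fun a => ?_⟩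
    refine u.symm_apply_eq.mpr ?_
    exact LinearMap.congr_fun hs a
  | succ n ih =>
    obtain ⟨m, π, hπ⟩ := Module.Finite.exists_fin' R D
    have hf : Function.Injective (LinearMap.ker π).subtype := Subtype.val_injective
    have hfg : Function.Exact (LinearMap.ker π).subtype π := LinearMap.exact_subtype_ker_map π
    revert e
    rw [ext_succ_eq_zero_iff hf hπ hfg] at h ⊢
    exact ih _ h

theorem ExtVanish.of_isLocalizedModule [IsNoetherianRing R] (S : Submonoid R) {M L : Type u}
    [AddCommGroup M] [Module R M] [AddCommGroup L] [Module R L] (ℓ : M →ₗ[R] L)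
    [IsLocalizedModule S ℓ] {D : Type u} [AddCommGroup D] [Module R D] [Module.Finite R D]
    (h : ExtVanish (R := R) D M) : ExtVanish (R := R) D L :=
  fun n => ext_eq_zero_of_isLocalizedModule S ℓ n D (h n)

variable {D : Type u} [AddCommGroup D] [Module R D] {A B C : Type u} [AddCommGroup A] [Module R A]
  [AddCommGroup B] [Module R B] [AddCommGroup C] [Module R C] {f : A →ₗ[R] B} {g : B →ₗ[R] C}

theorem ExtVanish.of_exact (hA : ExtVanish (R := R) D A) (hB : ExtVanish (R := R) D B)
    (hf : Function.Injective f) (hg : Function.Surjective g) (hfg : Function.Exact f g) :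
    ExtVanish (R := R) D C := by
  intro n e
  obtain ⟨x, rfl⟩ := Abelian.Ext.covariant_sequence_exact₃ (ModuleCat.of R D)
    (moduleCat_shortExact hf hg hfg) e rfl (hA (n + 1) _)
  rw [hB n x, Abelian.Ext.zero_comp]

theorem ExtVanish.exists_lift (hA : ExtVanish (R := R) D A)
    (hf : Function.Injective f) (hg : Function.Surjective g) (hfg : Function.Exact f g)
    (φ : D →ₗ[R] C) : ∃ ψ : D →ₗ[R] B, g ∘ₗ ψ = φ := by
  obtain ⟨x, hx⟩ := Abelian.Ext.covariant_sequence_exact₃ (ModuleCat.of R D)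
    (moduleCat_shortExact hf hg hfg) (Abelian.Ext.mk₀ (ModuleCat.ofHom φ)) rfl (hA 0 _)
  obtain ⟨ψ, rfl⟩ := (Abelian.Ext.mk₀_bijective _ _).2 x
  rw [Abelian.Ext.mk₀_comp_mk₀] at hx
  have := (Abelian.Ext.mk₀_bijective _ _).1 hx
  exact ⟨ψ.hom, congrArg ModuleCat.Hom.hom this⟩

theorem hasInjectiveDimensionLT_localizedModule [IsNoetherianRing R] (S : Submonoid R) (n : ℕ)
    (M : ModuleCat.{u} R) (hM : HasInjectiveDimensionLT M (n + 1)) :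
    HasInjectiveDimensionLT (ModuleCat.of R (LocalizedModule S M)) (n + 1) := by
  induction n generalizing M with
  | zero =>
    have hinj : Module.Injective R M := (Module.injective_iff_injective_object R M).mpr
      (injective_iff_hasInjectiveDimensionLT_one.mpr hM)
    exact injective_iff_hasInjectiveDimensionLT_one.mp
      ((Module.injective_iff_injective_object R _).mp (hinj.localizedModule S))
  | succ n ih =>
    obtain ⟨J, hJ, f, hf⟩ := exists_injective_embedding R M
    have hg := Submodule.mkQ_surjective (LinearMap.range f)
    have hfg : Function.Exact f (LinearMap.range f).mkQ := LinearMap.exact_map_mkQ_range f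
    have hC := ih (ModuleCat.of R (J ⧸ LinearMap.range f))
      (((moduleCat_shortExact hf hg hfg).hasInjectiveDimensionLT_X₃_iff n
        ((Module.injective_iff_injective_object R J).mp hJ)).mpr hM)
    let ℓ := fun (N : Type u) [AddCommGroup N] [Module R N] => LocalizedModule.mkLinearMap S N
    have hS := moduleCat_shortExact
      (IsLocalizedModule.map_injective S (ℓ M) (ℓ J) f hf)
      (IsLocalizedModule.map_surjective S (ℓ J) (ℓ (J ⧸ LinearMap.range f)) _ hg)
      (IsLocalizedModule.map_exact S (ℓ M) (ℓ J) (ℓ (J ⧸ LinearMap.range f)) _ _ hfg)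
    exact (hS.hasInjectiveDimensionLT_X₃_iff n
      ((Module.injective_iff_injective_object R _).mp (hJ.localizedModule S))).mp hC

theorem InjDimLE.hasInjectiveDimensionLT (n : ℕ) (M : ModuleCat.{u} R) (hM : InjDimLE R n M) :
    HasInjectiveDimensionLT M (n + 1) := by
  induction n generalizing M with
  | zero =>
    exact injective_iff_hasInjectiveDimensionLT_one.mp
      ((Module.injective_iff_injective_object R M).mp hM)
  | succ n ih =>
    obtain ⟨J, hJ, f, hf, hC⟩ := hM
    have hg := Submodule.mkQ_surjective (LinearMap.range f)
    have hfg : Function.Exact f (LinearMap.range f).mkQ := LinearMap.exact_map_mkQ_range f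
    exact ((moduleCat_shortExact hf hg hfg).hasInjectiveDimensionLT_X₃_iff n
        ((Module.injective_iff_injective_object R J).mp hJ)).mp (ih _ hC)

end ExtLocalization

section CechModule

variable {R : Type u} [CommRing R] {D M L M' : Type u} [AddCommGroup D] [Module R D]
  [AddCommGroup M] [Module R M] [AddCommGroup L] [Module R L] [AddCommGroup M'] [Module R M']

theorem IsCechStep.linearMap [Module.Finite R D] {x : R} {f : M →ₗ[R] L} {g : L →ₗ[R] M'}
    (h : IsCechStep x f g) (hlift : ∀ φ : D →ₗ[R] M', ∃ ψ : D →ₗ[R] L, g ∘ₗ ψ = φ) :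
    IsCechStep x (f.compRight R (M := D)) (g.compRight R (M := D)) where
  injective φ ψ hφψ := LinearMap.ext fun d => h.injective (LinearMap.congr_fun hφψ d)
  bijective := by
    refine ⟨fun φ ψ hφψ => LinearMap.ext fun d => h.bijective.1 (LinearMap.congr_fun hφψ d),
      fun φ => ?_⟩
    let e : L ≃ₗ[R] L := LinearEquiv.ofBijective (LinearMap.lsmul R L x) h.bijective
    exact ⟨e.symm.toLinearMap ∘ₗ φ, LinearMap.ext fun d => e.apply_symm_apply (φ d)⟩
  exists_pow φ := by
    obtain ⟨s, hs⟩ := Module.Finite.fg_top (R := R) (M := D)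
    choose n m hn using fun d => h.exists_pow (φ d)
    have hle : ⊤ ≤ (LinearMap.range f).comap (x ^ (∑ d ∈ s, n d) • φ) := by
      rw [← hs, Submodule.span_le]
      intro d hd
      obtain ⟨c, hc⟩ := Nat.exists_eq_add_of_le (Finset.single_le_sum (f := n)
        (fun _ _ => Nat.zero_le _) hd)
      refine ⟨x ^ c • m d, ?_⟩
      rw [map_smul, ← hn, LinearMap.smul_apply, smul_smul, ← pow_add, hc, add_comm]
    let e := LinearEquiv.ofInjective f h.injective
    refine ⟨∑ d ∈ s, n d, e.symm.toLinearMap ∘ₗ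
      (x ^ (∑ d ∈ s, n d) • φ).codRestrict (LinearMap.range f) (fun d => hle trivial),
      LinearMap.ext fun d => ?_⟩
    exact (congrArg Subtype.val (e.apply_symm_apply
      ⟨(x ^ (∑ d ∈ s, n d) • φ) d, hle trivial⟩)).symm
  surjective := hlift
  exact φ := by
    refine ⟨fun hφ => ?_, ?_⟩
    · let e := LinearEquiv.ofInjective f h.injective
      refine ⟨e.symm.toLinearMap ∘ₗ φ.codRestrict (LinearMap.range f)
        (fun d => (h.exact _).mp (LinearMap.congr_fun hφ d)), LinearMap.ext fun d => ?_⟩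
      exact congrArg Subtype.val (e.apply_symm_apply _)
    · rintro ⟨ψ, rfl⟩
      exact LinearMap.ext fun d => h.exact.apply_apply_eq_zero _

theorem isCechStep_localizedModule {x : R} (hx : ∀ m : M, x • m = 0 → m = 0) :
    IsCechStep x (LocalizedModule.mkLinearMap (Submonoid.powers x) M)
      (LinearMap.range (LocalizedModule.mkLinearMap (Submonoid.powers x) M)).mkQ where
  injective := by
    refine (injective_iff_map_eq_zero _).mpr fun m hm => ?_
    obtain ⟨⟨_, n, rfl⟩, hn⟩ := (IsLocalizedModule.eq_zero_iff (Submonoid.powers x) _).mp hm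
    replace hn : x ^ n • m = 0 := hn
    induction n with
    | zero => simpa using hn
    | succ n ih =>
      rw [pow_succ', mul_smul] at hn
      exact ih (hx _ hn)
  bijective := (Module.End.isUnit_iff _).mp
    (IsLocalizedModule.map_units (LocalizedModule.mkLinearMap (Submonoid.powers x) M)
      ⟨x, Submonoid.mem_powers x⟩)
  exists_pow l := by
    obtain ⟨⟨m, ⟨_, n, rfl⟩⟩, hm⟩ := IsLocalizedModule.surj (Submonoid.powers x)
      (LocalizedModule.mkLinearMap (Submonoid.powers x) M) l
    exact ⟨n, m, hm⟩
  surjective := Submodule.mkQ_surjective _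
  exact := LinearMap.exact_map_mkQ_range _

theorem IsLocalAt.localizedModule {p : Ideal R} (hM : IsLocalAt p M) (S : Submonoid R) :
    IsLocalAt p (LocalizedModule S M) := by
  intro r hr
  have h : Function.Bijective (IsLocalizedModule.map S (LocalizedModule.mkLinearMap S M)
      (LocalizedModule.mkLinearMap S M) (LinearMap.lsmul R M r)) :=
    ⟨IsLocalizedModule.map_injective S _ _ _ (hM r hr).1,
      IsLocalizedModule.map_surjective S _ _ _ (hM r hr).2⟩
  have : IsLocalizedModule.map S (LocalizedModule.mkLinearMap S M)
    (LocalizedModule.mkLinearMap S M) (LinearMap.lsmul R M r) =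
      LinearMap.lsmul R (LocalizedModule S M) r := by
    refine IsLocalizedModule.ext S (LocalizedModule.mkLinearMap S M)
      (IsLocalizedModule.map_units (LocalizedModule.mkLinearMap S M)) ?_
    ext m
    change IsLocalizedModule.map S _ _ _ (LocalizedModule.mkLinearMap S M m) =
      r • LocalizedModule.mkLinearMap S M m
    rw [IsLocalizedModule.map_apply, LinearMap.lsmul_apply, map_smul]
  rw [this] at h
  exact h

/-- The properties of the local cohomology module of `D` localized at `p`, in degree the length
of `K` and with respect to a sequence `K` which becomes regular in `R_p`, when `D` is
dualizing. -/
structure IsCechModule (p : Ideal R) (K : List R) (D M : Type u) [AddCommGroup D] [Module R D]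
    [AddCommGroup M] [Module R M] : Prop where
  isLocalAt : IsLocalAt p M
  isTorsionBy : IsTorsionBy K M
  isCoregular : IsCoregular K M
  extVanish : ExtVanish (R := R) D M
  exists_dim : ∃ n : ℕ, HasInjectiveDimensionLT (ModuleCat.of R M) (n + 1)
  hom_isCoregular : IsCoregular K (D →ₗ[R] M)
  hom_isSocleCyclic : IsSocleCyclic p K (D →ₗ[R] M)

theorem IsCechModule.exists_step [IsNoetherianRing R] [Module.Finite R D]
    (hD : Module.annihilator R D = ⊥) {p : Ideal R} [p.IsPrime] {K : List R} {x : R}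
    (h : IsCechModule p K D M) (hK : IsRegularAt p (x :: K)) :
    ∃ (L M' : ModuleCat.{u} R) (f : M →ₗ[R] L) (g : L →ₗ[R] M'), IsCechModule p (x :: K) D M' ∧
      IsCechStep x (f.compRight R (M := D)) (g.compRight R (M := D)) := by
  have hx : ∀ m : M, x • m = 0 → m = 0 := by
    by_contra! ⟨m, hm, hm0⟩
    obtain ⟨φ, hφ, -, hφx⟩ := exists_linearMap_ne_zero_of_isTorsionBy (D := D) hD h.isTorsionBy
      (LinearMap.ker (LinearMap.lsmul R M x)) fun hbot => hm0 (by
        rwa [← Submodule.mem_bot R, ← hbot, LinearMap.mem_ker])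
    exact hφ (h.hom_isSocleCyclic.smul_injective h.isTorsionBy.linearMap h.isLocalAt.linearMap hK
      φ (LinearMap.ext hφx))
  have hstep := isCechStep_localizedModule hx
  have hExt := h.extVanish.of_isLocalizedModule (Submonoid.powers x)
    (LocalizedModule.mkLinearMap (Submonoid.powers x) M)
  have hHom := hstep.linearMap (D := D)
    (h.extVanish.exists_lift hstep.injective hstep.surjective hstep.exact)
  refine ⟨ModuleCat.of R (LocalizedModule (Submonoid.powers x) M), ModuleCat.of R (_ ⧸
    LinearMap.range (LocalizedModule.mkLinearMap (Submonoid.powers x) M)), _, _, ⟨?_, ?_, ?_, ?_, ?_, ?_, ?_⟩, hHom⟩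
  · exact (h.isLocalAt.localizedModule _).quotient h.isLocalAt hstep.surjective hstep.exact
  · exact hstep.isTorsionBy h.isTorsionBy
  · exact hstep.isCoregular h.isCoregular
  · exact h.extVanish.of_exact hExt hstep.injective hstep.surjective hstep.exact
  · obtain ⟨n, hn⟩ := h.exists_dim
    have hS := moduleCat_shortExact hstep.injective hstep.surjective hstep.exact
    have h2 := hasInjectiveDimensionLT_localizedModule (Submonoid.powers x) n _ hn
    have h1 : HasInjectiveDimensionLT (ModuleCat.of R M) (n + 1 + 1) :=
      hasInjectiveDimensionLT_of_ge _ (n + 1) _ (by omega)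
    exact ⟨n, hS.hasInjectiveDimensionLT_X₃ (n + 1) h2 h1⟩
  · exact hHom.isCoregular h.hom_isCoregular
  · exact hHom.isSocleCyclic h.hom_isCoregular h.hom_isSocleCyclic

theorem isSocleCyclic_linearMap_localizedModule [IsNoetherianRing R] [Module.Finite R D]
    (hD : Function.Bijective (fun r : R => (r • LinearMap.id : D →ₗ[R] D)))
    (p : Ideal R) [p.IsPrime] :
    IsSocleCyclic p [] (D →ₗ[R] LocalizedModule p.primeCompl D) := by
  have := Module.finitePresentation_of_finite R D
  let ℓ := LocalizedModule.mkLinearMap p.primeCompl D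
  refine ⟨ℓ, by simp, fun φ _ => ?_, fun a ha => ?_⟩
  · obtain ⟨ψ, s, hs⟩ := Module.FinitePresentation.exists_lift_of_isLocalizedModule
      p.primeCompl ℓ φ
    obtain ⟨a, rfl⟩ := hD.2 ψ
    refine ⟨s, s.2, a, ?_⟩
    change s • φ = _
    rw [← hs]
    ext d
    simp [ℓ]
  · obtain ⟨s, hs⟩ := Module.Finite.exists_smul_of_comp_eq_of_isLocalizedModule p.primeCompl ℓ
      (a • LinearMap.id) (0 : D →ₗ[R] D) (by
        rw [LinearMap.comp_smul, LinearMap.comp_id, ha, LinearMap.comp_zero])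
    refine ⟨s, s.2, ?_⟩
    have : (s : R) * a = 0 := hD.1 (by
      simp only [zero_smul, mul_smul]
      rw [smul_zero] at hs
      exact hs)
    rw [this]
    exact zero_mem _

theorem IsDualizing.isCechModule [IsNoetherianRing R] (hD : IsDualizing R D) (p : Ideal R)
    [p.IsPrime] : IsCechModule p [] D (LocalizedModule p.primeCompl D) := by
  have := hD.1.1
  refine ⟨isLocalAt_localizedModule p D, fun m k hk => by simp at hk, trivial, ?_, ?_, trivial,
    isSocleCyclic_linearMap_localizedModule hD.1.2.1 p⟩
  · exact (extVanish_of_subsingleton_extM hD.1.2.2).of_isLocalizedModule p.primeCompl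
      (LocalizedModule.mkLinearMap p.primeCompl D)
  · obtain ⟨n, hn⟩ := hD.2
    exact ⟨n, hasInjectiveDimensionLT_localizedModule p.primeCompl n _
      (hn.hasInjectiveDimensionLT n _)⟩

theorem IsDualizing.annihilator_eq_bot (hD : IsDualizing R D) : Module.annihilator R D = ⊥ := by
  refine eq_bot_iff.mpr fun r hr => hD.1.2.1.1 ?_
  ext d
  simp [Module.mem_annihilator.mp hr d]

end CechModule

section TorSequence

variable {R : Type u} [CommRing R]

theorem homology_smul_bijective {K : ChainComplex (ModuleCat.{u} R) ℕ} {x : R}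
    (hx : ∀ i, Function.Bijective (fun m : K.X i => x • m)) (i : ℕ) :
    Function.Bijective (fun m : K.homology i => x • m) := by
  let φ : K ⟶ K := x • 𝟙 K
  have : ∀ i, IsIso (φ.f i) := fun i => by
    rw [ConcreteCategory.isIso_iff_bijective]
    exact hx i
  have : IsIso φ := HomologicalComplex.Hom.isIso_of_components φ
  have h : IsIso (HomologicalComplex.homologyMap φ i) := inferInstance
  rw [ConcreteCategory.isIso_iff_bijective] at h
  have h' : HomologicalComplex.homologyMap φ i = x • 𝟙 (K.homology i) := by
    rw [← HomologicalComplex.homologyMap_id]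
    exact ShortComplex.homologyMap_smul (φ := 𝟙 (K.sc i)) x
  rw [h'] at h
  exact h

theorem homology_exists_pow_smul_eq_zero {K : ChainComplex (ModuleCat.{u} R) ℕ} {x : R}
    (hx : ∀ i, ∀ m : K.X i, ∃ n : ℕ, x ^ n • m = 0) (i : ℕ) (m : K.homology i) :
    ∃ n : ℕ, x ^ n • m = 0 := by
  obtain ⟨z, rfl⟩ := (ModuleCat.epi_iff_surjective (K.homologyπ i)).mp inferInstance m
  obtain ⟨n, hn⟩ := hx i (K.iCycles i z)
  refine ⟨n, ?_⟩
  rw [← map_smul, show x ^ n • z = 0 from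
    (ModuleCat.mono_iff_injective (K.iCycles i)).mp inferInstance ?_, map_zero]
  rw [map_smul, hn, map_zero]

/-- The complex `M ⊗ P` for a projective resolution `P` of `G`. -/
noncomputable def tensorComplex {G : ModuleCat.{u} R} (P : ProjectiveResolution G)
    (M : Type u) [AddCommGroup M] [Module R M] : ChainComplex (ModuleCat.{u} R) ℕ :=
  (((MonoidalCategory.tensoringLeft (ModuleCat.{u} R)).obj
    (ModuleCat.of R M)).mapHomologicalComplex _).obj P.complex

/-- The homology of `M ⊗ P` computes the modules `Tor`. -/
noncomputable def torEquivHomology {G : Type u} [AddCommGroup G] [Module R G]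
    (P : ProjectiveResolution (ModuleCat.of R G)) (M : Type u) [AddCommGroup M] [Module R M]
    (i : ℕ) : TorM R i M G ≃ₗ[R] (tensorComplex P M).homology i :=
  (P.isoLeftDerivedObj ((MonoidalCategory.tensoringLeft (ModuleCat.{u} R)).obj
    (ModuleCat.of R M)) i).toLinearEquiv

variable {G : Type u} [AddCommGroup G] [Module R G] {A B C : Type u} [AddCommGroup A] [Module R A]
  [AddCommGroup B] [Module R B] [AddCommGroup C] [Module R C] {f : A →ₗ[R] B} {g : B →ₗ[R] C}

theorem torM_smul_bijective {x : R} (hx : Function.Bijective (fun a : A => x • a)) (i : ℕ) :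
    Function.Bijective (fun m : TorM R i A G => x • m) := by
  let P := projectiveResolution (ModuleCat.of R G)
  let e := torEquivHomology P A i
  have h := homology_smul_bijective (K := tensorComplex P A) (x := x) (fun j => by
    let u : A ≃ₗ[R] A := LinearEquiv.ofBijective (LinearMap.lsmul R A x) hx
    have hu : ∀ t, (u.rTensor (P.complex.X j)) t = x • t := fun t => by
      have : (u.rTensor (P.complex.X j)).toLinearMap = x • LinearMap.id := by
        ext a b
        rfl
      exact LinearMap.congr_fun this t
    have hb := (u.rTensor (P.complex.X j)).bijective
    exact (funext hu) ▸ hb) i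
  have : (fun m : TorM R i A G => x • m) = e.symm ∘ (fun m => x • m) ∘ e := by
    ext m
    simp
  rw [this]
  exact e.symm.bijective.comp (h.comp e.bijective)

theorem torM_exists_pow_smul_eq_zero {x : R} (hx : ∀ a : A, ∃ n : ℕ, x ^ n • a = 0) (i : ℕ)
    (m : TorM R i A G) : ∃ n : ℕ, x ^ n • m = 0 := by
  let P := projectiveResolution (ModuleCat.of R G)
  let e := torEquivHomology P A i
  obtain ⟨n, hn⟩ := homology_exists_pow_smul_eq_zero (K := tensorComplex P A) (x := x)
    (fun j t => by
      change TensorProduct R A (P.complex.X j) at t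
      change ∃ n : ℕ, x ^ n • t = 0
      induction t using TensorProduct.induction_on with
      | zero => exact ⟨0, smul_zero _⟩
      | tmul a b =>
        obtain ⟨n, hn⟩ := hx a
        exact ⟨n, by rw [TensorProduct.smul_tmul', hn, TensorProduct.zero_tmul]⟩
      | add s t hs ht =>
        obtain ⟨n, hn⟩ := hs
        obtain ⟨m, hm⟩ := ht
        refine ⟨n + m, ?_⟩
        rw [smul_add, pow_add, mul_smul _ _ t, hm, mul_comm, mul_smul, hn, smul_zero, smul_zero,
          add_zero]) i (e m)
  exact ⟨n, e.injective (by rw [map_smul, hn, map_zero])⟩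

theorem exists_torM_exact (G : Type u) [AddCommGroup G] [Module R G]
    (hf : Function.Injective f) (hg : Function.Surjective g) (hfg : Function.Exact f g) :
    ∃ (a : ∀ i, TorM R i A G →ₗ[R] TorM R i B G) (b : ∀ i, TorM R i B G →ₗ[R] TorM R i C G)
      (δ : ∀ i, TorM R (i + 1) C G →ₗ[R] TorM R i A G),
      (∀ i, Function.Exact (a i) (b i)) ∧ (∀ i, Function.Exact (b (i + 1)) (δ i)) ∧
      ∀ i, Function.Exact (δ i) (a i) := by
  let P := projectiveResolution (ModuleCat.of R G)
  let T := MonoidalCategory.tensoringLeft (ModuleCat.{u} R)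
  let S : ShortComplex (ChainComplex (ModuleCat.{u} R) ℕ) :=
    { X₁ := tensorComplex P A
      X₂ := tensorComplex P B
      X₃ := tensorComplex P C
      f := (NatTrans.mapHomologicalComplex (T.map (ModuleCat.ofHom f)) _).app P.complex
      g := (NatTrans.mapHomologicalComplex (T.map (ModuleCat.ofHom g)) _).app P.complex
      zero := by
        ext i t
        exact (rTensor_exact (P.complex.X i) hfg hg).apply_apply_eq_zero t }
  have hS : S.ShortExact := by
    refine HomologicalComplex.shortExact_of_degreewise_shortExact _ fun i => ?_
    have := (IsProjective.iff_projective (R := R) (P.complex.X i)).mpr (P.projective i)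
    exact moduleCat_shortExact (Module.Flat.rTensor_preserves_injective_linearMap f hf)
      (LinearMap.rTensor_surjective (P.complex.X i) hg) (rTensor_exact (P.complex.X i) hfg hg)
  let eA := torEquivHomology P A
  let eB := torEquivHomology P B
  let eC := torEquivHomology P C
  refine ⟨fun i => (eB i).symm ∘ₗ (HomologicalComplex.homologyMap S.f i).hom ∘ₗ eA i,
    fun i => (eC i).symm ∘ₗ (HomologicalComplex.homologyMap S.g i).hom ∘ₗ eB i,
    fun i => (eA i).symm ∘ₗ (hS.δ (i + 1) i (by simp)).hom ∘ₗ eC (i + 1), fun i => ?_, fun i => ?_, fun i => ?_⟩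
  · exact (Function.Exact.iff_of_ladder_linearEquiv (e₁ := eA i) (e₂ := eB i) (e₃ := eC i)
      (by ext; simp) (by ext; simp)).mp
      ((ShortComplex.ShortExact.moduleCat_exact_iff_function_exact _).mp (hS.homology_exact₂ i))
  · exact (Function.Exact.iff_of_ladder_linearEquiv (e₁ := eB (i + 1)) (e₂ := eC (i + 1))
      (e₃ := eA i) (by ext; simp) (by ext; simp)).mp
      ((ShortComplex.ShortExact.moduleCat_exact_iff_function_exact _).mp
        (hS.homology_exact₃ (i + 1) i (by simp)))
  · exact (Function.Exact.iff_of_ladder_linearEquiv (e₁ := eC (i + 1)) (e₂ := eA i)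
      (e₃ := eB i) (by ext; simp) (by ext; simp)).mp
      ((ShortComplex.ShortExact.moduleCat_exact_iff_function_exact _).mp
        (hS.homology_exact₁ (i + 1) i (by simp)))

/-- `Tor_i(H, G)` vanishes above the length of `K`, and in that degree it is the submodule of
`G_p` of elements annihilated by powers of the elements of `K`. -/
def IsTorTorsion (p : Ideal R) [p.IsPrime] (K : List R) (H G : Type u) [AddCommGroup H]
    [Module R H] [AddCommGroup G] [Module R G] : Prop :=
  (∀ i, K.length < i → Subsingleton (TorM R i H G)) ∧
    ∃ ι : TorM R K.length H G →ₗ[R] LocalizedModule p.primeCompl G, Function.Injective ι ∧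
      ∀ m, m ∈ LinearMap.range ι ↔ ∀ k ∈ K, ∃ n : ℕ, k ^ n • m = 0

theorem IsCechStep.isTorTorsion {p : Ideal R} [p.IsPrime] {K : List R} {x : R}
    (h : IsCechStep x f g) (hA : IsTorTorsion p K A G) : IsTorTorsion p (x :: K) C G := by
  obtain ⟨hA0, ι, hι, hιK⟩ := hA
  obtain ⟨a, b, δ, hab, hbδ, hδa⟩ :=
    exists_torM_exact G h.injective h.surjective h.exact
  have htors := torM_exists_pow_smul_eq_zero (G := G) (fun c : C =>
    (h.isTorsionBy (K := []) (fun _ _ hk => by simp at hk)) c x List.mem_cons_self)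
  have hB : ∀ i (n : ℕ) (m : TorM R i B G), x ^ n • m = 0 → m = 0 := fun i n m hm =>
    (torM_smul_bijective (G := G) (h.pow_bijective n) i).1 (hm.trans (smul_zero _).symm)
  have hB0 : ∀ i, K.length < i → ∀ m : TorM R i B G, m = 0 := by
    intro i hi m
    obtain ⟨n, hn⟩ := htors i (b i m)
    rw [← map_smul] at hn
    obtain ⟨y, hy⟩ := (hab i _).mp hn
    refine hB i n m ?_
    rw [← hy, (hA0 i hi).elim y 0, map_zero]
  have hδ : ∀ i, K.length ≤ i → Function.Injective (δ i) := fun i hi =>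
    (injective_iff_map_eq_zero _).mpr fun m hm => by
      obtain ⟨y, rfl⟩ := (hbδ i _).mp hm
      rw [hB0 (i + 1) (by omega) y, map_zero]
  refine ⟨fun i hi => ?_, ι ∘ₗ δ K.length, hι.comp (hδ _ le_rfl), fun m => ⟨?_, fun hm => ?_⟩⟩
  · obtain ⟨j, rfl⟩ : ∃ j, i = j + 1 := ⟨i - 1, by omega⟩
    rw [List.length_cons] at hi
    have := hA0 j (by omega)
    exact (hδ j (by omega)).subsingleton
  · rintro ⟨y, rfl⟩ k hk
    rcases List.mem_cons.mp hk with rfl | hk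
    · obtain ⟨n, hn⟩ := htors _ y
      exact ⟨n, by rw [← map_smul, hn, map_zero]⟩
    · exact (hιK _).mp (LinearMap.mem_range_self ι _) k hk
  · obtain ⟨y, rfl⟩ := (hιK m).mpr fun k hk => hm k (List.mem_cons_of_mem _ hk)
    obtain ⟨n, hn⟩ := hm x List.mem_cons_self
    rw [← map_smul, map_eq_zero_iff ι hι] at hn
    obtain ⟨z, rfl⟩ := (hδa _ y).mp (hB _ n _ (by rw [← map_smul, hn, map_zero]))
    exact ⟨z, rfl⟩

/-- The module `Tor` only depends on the isomorphism class of its first argument. -/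
noncomputable def torEquiv (e : A ≃ₗ[R] B) (i : ℕ) (G : Type u) [AddCommGroup G] [Module R G] :
    TorM R i A G ≃ₗ[R] TorM R i B G :=
  (((Tor (ModuleCat.{u} R) i).mapIso e.toModuleIso).app (ModuleCat.of R G)).toLinearEquiv

theorem IsTorTorsion.of_linearEquiv {p : Ideal R} [p.IsPrime] {K : List R}
    (h : IsTorTorsion p K A G) (e : A ≃ₗ[R] B) : IsTorTorsion p K B G := by
  obtain ⟨h0, ι, hι, hK⟩ := h
  refine ⟨fun i hi => ?_, ι ∘ₗ (torEquiv e _ G).symm.toLinearMap,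
    hι.comp (torEquiv e _ G).symm.injective, ?_⟩
  · have := h0 i hi
    exact (torEquiv e i G).symm.injective.subsingleton
  · rwa [LinearEquiv.range_comp]

theorem subsingleton_torM_succ_of_flat [Module.Flat R A] (i : ℕ) :
    Subsingleton (TorM R (i + 1) A G) := by
  let P := projectiveResolution (ModuleCat.of R G)
  have h0 : IsZero ((tensorComplex P A).homology (i + 1)) := by
    rw [← HomologicalComplex.exactAt_iff_isZero_homology,
      HomologicalComplex.exactAt_iff' _ (i + 2) (i + 1) i (by simp) (by simp)]
    have := P.complex_exactAt_succ i
    rw [HomologicalComplex.exactAt_iff' _ (i + 2) (i + 1) i (by simp) (by simp),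
      ShortComplex.ShortExact.moduleCat_exact_iff_function_exact] at this
    rw [ShortComplex.ShortExact.moduleCat_exact_iff_function_exact]
    exact Module.Flat.lTensor_exact A (f := (P.complex.d (i + 2) (i + 1)).hom)
      (g := (P.complex.d (i + 1) i).hom) this
  have := ModuleCat.isZero_iff_subsingleton.mp h0
  exact (torEquivHomology P A (i + 1)).injective.subsingleton

theorem isTorTorsion_localization (p : Ideal R) [p.IsPrime] (G : Type u) [AddCommGroup G]
    [Module R G] : IsTorTorsion p [] (Localization p.primeCompl) G := by
  have := IsLocalization.flat (Localization p.primeCompl) p.primeCompl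
  refine ⟨fun i hi => ?_, ?_⟩
  · obtain ⟨j, rfl⟩ : ∃ j, i = j + 1 := ⟨i - 1, by rw [List.length_nil] at hi; omega⟩
    exact subsingleton_torM_succ_of_flat j
  · let T := (MonoidalCategory.tensoringLeft (ModuleCat.{u} R)).obj
      (ModuleCat.of R (Localization p.primeCompl))
    have : PreservesFiniteColimits T := inferInstanceAs (PreservesFiniteColimits
      (MonoidalCategory.tensorLeft (ModuleCat.of R (Localization p.primeCompl))))
    let e₀ : TorM R 0 (Localization p.primeCompl) G ≃ₗ[R]
        TensorProduct R (Localization p.primeCompl) G :=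
      (T.leftDerivedZeroIsoSelf.app (ModuleCat.of R G)).toLinearEquiv
    let e := e₀ ≪≫ₗ (LocalizedModule.equivTensorProduct p.primeCompl G).symm.restrictScalars R
    exact ⟨e.toLinearMap, e.injective, fun m => by simp⟩

theorem IsSocleCyclic.nonempty_localization_equiv {p : Ideal R} [hp : p.IsPrime]
    (h : IsSocleCyclic p [] A) (hA : IsLocalAt p A) :
    Nonempty (Localization p.primeCompl ≃ₗ[R] A) := by
  obtain ⟨e, -, hgen, hann⟩ := h
  have : IsLocalizedModule p.primeCompl (LinearMap.toSpanSingleton R A e) :=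
    { map_units := fun s => (Module.End.isUnit_iff _).mpr (hA s s.2)
      surj := fun y => by
        obtain ⟨s, hs, a, ha⟩ := hgen y (by simp)
        exact ⟨(a, ⟨s, hs⟩), ha⟩
      exists_of_eq := fun {a b} hab => by
        obtain ⟨s, hs, hsab⟩ := hann (a - b) (by
          rw [sub_smul, sub_eq_zero]
          exact hab)
        refine ⟨⟨s, hs⟩, ?_⟩
        rw [Ideal.ofList_nil, Ideal.mem_bot, mul_sub, sub_eq_zero] at hsab
        exact hsab }
  exact ⟨IsLocalizedModule.linearEquiv p.primeCompl
    (Algebra.linearMap R (Localization p.primeCompl)) (LinearMap.toSpanSingleton R A e)⟩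
end TorSequence

section TorDecomposition

variable {R : Type u} [CommRing R] [IsNoetherianRing R] {D : Type u} [AddCommGroup D]
  [Module R D]

theorem IsDualizing.exists_isCechModule (hD : IsDualizing R D) (p : Ideal R) [p.IsPrime]
    {K : List R} (hK : IsRegularAt p K) (G : Type u) [AddCommGroup G] [Module R G] :
    ∃ M : ModuleCat.{u} R, IsCechModule p K D M ∧ IsTorTorsion p K (D →ₗ[R] M) G := by
  have := hD.1.1
  induction K with
  | nil =>
    have h := hD.isCechModule p
    obtain ⟨e⟩ := h.hom_isSocleCyclic.nonempty_localization_equiv h.isLocalAt.linearMap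
    exact ⟨ModuleCat.of R (LocalizedModule p.primeCompl D), h, (isTorTorsion_localization p G).of_linearEquiv e⟩
  | cons x K ih =>
    obtain ⟨M, hM, hT⟩ := ih hK.1
    obtain ⟨L, M', f, g, hM', hfg⟩ := hM.exists_step hD.annihilator_eq_bot hK
    exact ⟨M', hM', hfg.isTorTorsion hT⟩

theorem IsDualizing.nonempty_torM_equiv (hCM : IsCohenMacaulayRing R) (hD : IsDualizing R D)
    (p : PrimeSpectrum R) {k : ℕ} (hk : Order.height p = k) {E : Type u} [AddCommGroup E]
    [Module R E] (hE : IsInjectiveHull R (R ⧸ p.asIdeal) E) (G : Type u) [AddCommGroup G]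
    [Module R G] : Nonempty (TorM R k (D →ₗ[R] E) G ≃ₗ[R] LocalPart p G) := by
  have := hD.1.1
  obtain ⟨K, hK, rfl⟩ := hCM.exists_isRegularAt p hk
  have hp := hK.mem_minimalPrimes hk
  obtain ⟨M, hM, hT⟩ := hD.exists_isCechModule p.asIdeal hK G
  obtain ⟨n, hn⟩ := hM.exists_dim
  have hinj := injective_of_hasInjectiveDimensionLT hp hK n M hM.isLocalAt hM.isTorsionBy
    hM.isCoregular hn
  obtain ⟨e⟩ := hM.hom_isSocleCyclic.nonempty_equiv hD.annihilator_eq_bot hp hinj hM.isLocalAt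
    hM.isTorsionBy hE
  obtain ⟨-, ι, hι, hιK⟩ := hT.of_linearEquiv (LinearEquiv.congrRight e)
  have hrange : LinearMap.range ι = supportedSubmodule
      (PrimeSpectrum.zeroLocus (p.asIdeal : Set R)) (LocalizedModule p.asIdeal.primeCompl G) := by
    rw [← (isLocalAt_localizedModule p.asIdeal G).supportedSubmodule_eq hp]
    ext m
    rw [hιK, mem_supportedSubmodule_zeroLocus]
    rfl
  exact ⟨LinearEquiv.ofInjective ι hι ≪≫ₗ LinearEquiv.ofEq _ _ hrange⟩

end TorDecomposition

/-- Over a `d`-dimensional Cohen-Macaulay noetherian ring `R` with dualizing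
module `D`, every Gorenstein injective module `G` has a filtration
`0 = G_{d+1} ⊆ G_d ⊆ ⋯ ⊆ G_1 ⊆ G_0 = G` by Gorenstein injective submodules whose subsequent
quotients are Gorenstein injective and decompose as `G_k/G_{k+1} ≅ ⊕_{ht p = k} G_(p)` with
`G_(p) := Tor_k^R(Hom_R(D, E_R(R/p)), G)`, each `G_(p)` being Gorenstein injective and
satisfying `t(p)`. -/
theorem statement15 (R : Type u) [CommRing R] [IsNoetherianRing R]
    (hCM : IsCohenMacaulayRing R) (d : ℕ) (hd : ringKrullDim R = ((d : ℕ∞) : WithBot ℕ∞))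
    (D : Type u) [AddCommGroup D] [Module R D] (hD : IsDualizing R D)
    (E : PrimeSpectrum R → Type u) [∀ p, AddCommGroup (E p)] [∀ p, Module R (E p)]
    (hE : ∀ p : PrimeSpectrum R, IsInjectiveHull R (R ⧸ p.asIdeal) (E p))
    (G : Type u) [AddCommGroup G] [Module R G] (hG : GorensteinInjective R G) :
    -- each G_(p) is Gorenstein injective and satisfies t(p)
    (∀ (p : PrimeSpectrum R) (k : ℕ), (k : ℕ∞) = Order.height p →
      GorensteinInjective R (TorM R k (D →ₗ[R] E p) G) ∧
      PropT R p.asIdeal (TorM R k (D →ₗ[R] E p) G)) ∧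
    -- the filtration
    ∃ Gsub : Fin (d + 2) → Submodule R G,
      Antitone Gsub ∧ Gsub 0 = ⊤ ∧ Gsub (Fin.last (d + 1)) = ⊥ ∧
      (∀ k : Fin (d + 2), GorensteinInjective R ↥(Gsub k)) ∧
      (∀ k : Fin (d + 1),
        GorensteinInjective R
          (↥(Gsub k.castSucc) ⧸
            Submodule.comap (Gsub k.castSucc).subtype (Gsub k.succ)) ∧
        Nonempty ((↥(Gsub k.castSucc) ⧸
            Submodule.comap (Gsub k.castSucc).subtype (Gsub k.succ)) ≃ₗ[R]
          (⨁ p : {p : PrimeSpectrum R // Order.height p = ((k : ℕ) : ℕ∞)},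
            TorM R (k : ℕ) (D →ₗ[R] E p.1) G))) := by

  have hT : ∀ (k : ℕ) (p : PrimeSpectrum R), Order.height p = k →
      Nonempty (TorM R k (D →ₗ[R] E p) G ≃ₗ[R] LocalPart p G) := fun k p hk =>
    hD.nonempty_torM_equiv hCM p hk (hE p) G
  refine ⟨fun p k hk => ?_, ?_⟩
  · obtain ⟨e⟩ := hT k p hk.symm
    exact ⟨(hG.localPart p).of_linearEquiv e,
      (propT_of_isLocalAt (isLocalAt_localizedModule p.asIdeal G)).of_linearEquiv e⟩
  · exact hG.exists_filtration hd (fun k p => TorM R k (D →ₗ[R] E p) G) hT
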